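/- Let d ≥ 2 and assume a complete set of d+1 mutually unbiased bases exists in ℂ^d, with complete MUB ensemble M. Let S be any labelled union of d+1 orthonormal bases of ℂ^d (counting basis membership with multiplicity), and let H be a standard isotropic Gaussian Hamiltonian on ℂ^d. Then E_H min_{ψ∈M} Tr(H Q_ψ) ≤ E_H min_{ψ∈S} Tr(H Q_ψ): the complete MUB ensemble attains the smallest expected best-of-set random-Hamiltonian minimum among all unions of d+1 orthonormal bases. -/

import Mathlib

open MeasureTheory ProbabilityTheory Matrix

noncomputable section

/-- The centered projection `Q_ψ = |ψ⟩⟨ψ| − I/d` associated to a vector `ψ ∈ ℂ^d`. -/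
def Qmat {d : ℕ} (ψ : Fin d → ℂ) : Matrix (Fin d) (Fin d) ℂ :=
  Matrix.vecMulVec ψ (star ψ) - (d : ℂ)⁻¹ • (1 : Matrix (Fin d) (Fin d) ℂ)

/-- `B` is an orthonormal basis of `ℂ^d` (as a `d`-tuple of vectors). -/
def IsONB {d : ℕ} (B : Fin d → Fin d → ℂ) : Prop :=
  ∀ i j, star (B i) ⬝ᵥ B j = if i = j then (1 : ℂ) else 0

/-- `B` is a complete system of `d+1` mutually unbiased bases of `ℂ^d`. -/
def IsCompleteMUB {d : ℕ} (B : Fin (d + 1) → Fin d → Fin d → ℂ) : Prop :=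
  (∀ a, IsONB (B a)) ∧
    ∀ a b i j, a ≠ b → Complex.normSq (star (B a i) ⬝ᵥ B b j) = 1 / d

/-- `H` is a standard isotropic Gaussian Hamiltonian on `ℂ^d` under the probability
measure `μ`: it is `∑ k, g k • E k` for an orthonormal basis `E` of the real space of
traceless Hermitian `d×d` matrices (Hilbert–Schmidt inner product) and i.i.d. standard
real Gaussians `g k`. -/
def IsStdGaussianHamiltonian {d : ℕ} {Ω : Type*} [MeasurableSpace Ω]
    (μ : Measure Ω) (H : Ω → Matrix (Fin d) (Fin d) ℂ) : Prop :=
  ∃ (E : Fin (d ^ 2 - 1) → Matrix (Fin d) (Fin d) ℂ)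
    (g : Fin (d ^ 2 - 1) → Ω → ℝ),
      (∀ k, (E k).IsHermitian) ∧
      (∀ k, (E k).trace = 0) ∧
      (∀ k l, (E k * E l).trace = if k = l then (1 : ℂ) else 0) ∧
      Measurable (fun ω k => g k ω) ∧
      Measure.map (fun ω k => g k ω) μ =
        Measure.pi (fun _ : Fin (d ^ 2 - 1) => gaussianReal 0 1) ∧
      ∀ ω, H ω = ∑ k, (g k ω : ℂ) • E k

/-- `μ` is the centered Gaussian law with covariance matrix `C`. -/
structure IsCenteredGaussian {ι : Type*} [Fintype ι] (μ : Measure (ι → ℝ))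
    (C : Matrix ι ι ℝ) : Prop where
  prob : IsProbabilityMeasure μ
  charFun_eq : ∀ t : ι → ℝ, ∫ x, Complex.exp ((t ⬝ᵥ x : ℝ) * Complex.I) ∂μ =
    Complex.exp (-((t ⬝ᵥ C *ᵥ t : ℝ) : ℂ) / 2)

namespace IsCenteredGaussian

variable {ι κ l : Type*} [Fintype ι] [Fintype κ] [Fintype l]
  {μ : Measure (ι → ℝ)} {ν : Measure (κ → ℝ)} {C : Matrix ι ι ℝ} {D : Matrix κ κ ℝ}

lemma quadForm_nonneg (h : IsCenteredGaussian μ C) (t : ι → ℝ) : 0 ≤ t ⬝ᵥ C *ᵥ t := by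
  have := h.prob
  have h1 : ‖∫ x, Complex.exp ((t ⬝ᵥ x : ℝ) * Complex.I) ∂μ‖ ≤ 1 := by
    refine (norm_integral_le_integral_norm _).trans ?_
    simp [Complex.norm_exp_ofReal_mul_I]
  rw [h.charFun_eq, Complex.norm_exp] at h1
  have h2 : (-((t ⬝ᵥ C *ᵥ t : ℝ) : ℂ) / 2).re = -(t ⬝ᵥ C *ᵥ t) / 2 := by
    rw [← Complex.ofReal_neg]
    norm_cast
  rw [h2, Real.exp_le_one_iff] at h1
  linarith

lemma unique {ν : Measure (ι → ℝ)} {D : Matrix ι ι ℝ} (hμ : IsCenteredGaussian μ C)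
    (hν : IsCenteredGaussian ν D) (h : ∀ t, t ⬝ᵥ C *ᵥ t = t ⬝ᵥ D *ᵥ t) : μ = ν := by
  classical
  have := hμ.prob
  have := hν.prob
  refine Measure.ext_of_charFunDual (funext fun L => ?_)
  obtain ⟨v, hv⟩ : ∃ v : ι → ℝ, ∀ x, L x = v ⬝ᵥ x := by
    refine ⟨fun i => L (Pi.single i 1), fun x => ?_⟩
    conv_lhs => rw [← Finset.univ_sum_single x]
    rw [map_sum, dotProduct]
    refine Finset.sum_congr rfl fun i _ => ?_
    have : (Pi.single i (x i) : ι → ℝ) = x i • Pi.single i 1 := by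
      rw [← Pi.single_smul]; simp
    rw [this, map_smul, smul_eq_mul, mul_comm]
  simp only [charFunDual_apply, hv]
  rw [hμ.charFun_eq, hν.charFun_eq, h]

lemma map_prod (hμ : IsCenteredGaussian μ C) (hν : IsCenteredGaussian ν D)
    {E : Matrix l l ℝ} {f : (ι → ℝ) × (κ → ℝ) → l → ℝ} (hf : Measurable f)
    (a : (l → ℝ) → ι → ℝ) (b : (l → ℝ) → κ → ℝ)
    (hab : ∀ t z, t ⬝ᵥ f z = a t ⬝ᵥ z.1 + b t ⬝ᵥ z.2)
    (hq : ∀ t, a t ⬝ᵥ C *ᵥ a t + b t ⬝ᵥ D *ᵥ b t = t ⬝ᵥ E *ᵥ t) :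
    IsCenteredGaussian ((μ.prod ν).map f) E := by
  have := hμ.prob
  have := hν.prob
  refine ⟨Measure.isProbabilityMeasure_map hf.aemeasurable, fun t => ?_⟩
  rw [integral_map hf.aemeasurable]
  · simp only [hab, Complex.ofReal_add, add_mul, Complex.exp_add]
    rw [integral_prod_mul (fun x : ι → ℝ => Complex.exp ((a t ⬝ᵥ x : ℝ) * Complex.I))
      (fun x : κ → ℝ => Complex.exp ((b t ⬝ᵥ x : ℝ) * Complex.I)), hμ.charFun_eq, hν.charFun_eq,
      ← Complex.exp_add, ← hq t]
    congr 1
    push_cast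
    ring
  · refine (Measurable.aestronglyMeasurable ?_)
    unfold dotProduct
    fun_prop

lemma map (hμ : IsCenteredGaussian μ C) {E : Matrix l l ℝ} {f : (ι → ℝ) → l → ℝ}
    (hf : Measurable f) (a : (l → ℝ) → ι → ℝ) (ha : ∀ t x, t ⬝ᵥ f x = a t ⬝ᵥ x)
    (hq : ∀ t, a t ⬝ᵥ C *ᵥ a t = t ⬝ᵥ E *ᵥ t) :
    IsCenteredGaussian (μ.map f) E := by
  have := hμ.prob
  refine ⟨Measure.isProbabilityMeasure_map hf.aemeasurable, fun t => ?_⟩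
  rw [integral_map hf.aemeasurable]
  · simp only [ha]
    rw [hμ.charFun_eq, hq]
  · refine (Measurable.aestronglyMeasurable ?_)
    unfold dotProduct
    fun_prop

lemma map_mulVec (hμ : IsCenteredGaussian μ C) (A : Matrix l ι ℝ) :
    IsCenteredGaussian (μ.map (A *ᵥ ·)) (A * C * Aᵀ) := by
  refine hμ.map (by unfold mulVec dotProduct; fun_prop) (fun t => Aᵀ *ᵥ t) (fun t x => ?_)
    fun t => ?_
  · rw [mulVec_transpose, dotProduct_mulVec]
  · rw [← mulVec_mulVec, ← mulVec_mulVec, dotProduct_mulVec t A, mulVec_transpose]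

lemma std [DecidableEq ι] :
    IsCenteredGaussian (Measure.pi fun _ : ι => gaussianReal 0 1) (1 : Matrix ι ι ℝ) := by
  refine ⟨inferInstance, fun t => ?_⟩
  have h1 : ∀ x : ι → ℝ, Complex.exp ((t ⬝ᵥ x : ℝ) * Complex.I) =
      ∏ i, Complex.exp ((t i : ℂ) * (x i : ℂ) * Complex.I) := by
    intro x
    rw [← Complex.exp_sum, dotProduct]
    push_cast
    rw [Finset.sum_mul]
  simp only [h1]
  rw [integral_fintype_prod_eq_prod
    (f := fun i (x : ℝ) => Complex.exp ((t i : ℂ) * (x : ℂ) * Complex.I))]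
  simp only [← charFun_apply_real, charFun_gaussianReal]
  rw [← Complex.exp_sum, one_mulVec, dotProduct]
  congr 1
  push_cast
  rw [neg_div, Finset.sum_div, ← Finset.sum_neg_distrib]
  refine Finset.sum_congr rfl fun i _ => ?_
  simp
  ring

/-- The law of independent copies of a centered Gaussian vector. -/
lemma map_pi {I : Type*} [Fintype I] (hμ : IsCenteredGaussian μ C)
    {E : Matrix (ι × I) (ι × I) ℝ}
    (hq : ∀ t : ι × I → ℝ, ∑ i, (fun j => t (j, i)) ⬝ᵥ C *ᵥ (fun j => t (j, i)) = t ⬝ᵥ E *ᵥ t) :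
    IsCenteredGaussian ((Measure.pi fun _ : I => μ).map fun z (p : ι × I) => z p.2 p.1) E := by
  have := hμ.prob
  have hf : Measurable fun (z : I → ι → ℝ) (p : ι × I) => z p.2 p.1 := by fun_prop
  refine ⟨Measure.isProbabilityMeasure_map hf.aemeasurable, fun t => ?_⟩
  rw [integral_map hf.aemeasurable]
  · have h1 : ∀ z : I → ι → ℝ,
        Complex.exp ((t ⬝ᵥ (fun p : ι × I => z p.2 p.1) : ℝ) * Complex.I) =
        ∏ i, Complex.exp ((((fun j => t (j, i)) ⬝ᵥ z i : ℝ) : ℂ) * Complex.I) := by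
      intro z
      rw [← Complex.exp_sum, ← Finset.sum_mul, ← Complex.ofReal_sum]
      congr 3
      simp only [dotProduct]
      rw [Fintype.sum_prod_type, Finset.sum_comm]
    simp only [h1]
    rw [integral_fintype_prod_eq_prod (f := fun i (x : ι → ℝ) =>
      Complex.exp ((((fun j => t (j, i)) ⬝ᵥ x : ℝ) : ℂ) * Complex.I))]
    simp only [hμ.charFun_eq]
    rw [← Complex.exp_sum, ← hq t]
    congr 1
    push_cast
    rw [neg_div, Finset.sum_div, ← Finset.sum_neg_distrib]
    simp only [neg_div]
  · refine (Measurable.aestronglyMeasurable ?_)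
    unfold dotProduct
    fun_prop

end IsCenteredGaussian

lemma integral_exp_neg_mul_sq_gaussianReal {c : ℝ} (hc : 0 ≤ c) :
    ∫ y, Real.exp (-(c * y ^ 2) / 2) ∂(gaussianReal 0 1) = (1 + c) ^ (-(1 / 2) : ℝ) := by
  rw [integral_gaussianReal_eq_integral_smul one_ne_zero]
  have h1 : ∀ x : ℝ, gaussianPDFReal 0 1 x • Real.exp (-(c * x ^ 2) / 2) =
      (Real.sqrt (2 * Real.pi))⁻¹ * Real.exp (-((1 + c) / 2) * x ^ 2) := by
    intro x
    simp only [gaussianPDFReal, NNReal.coe_one, mul_one, sub_zero, smul_eq_mul]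
    rw [mul_assoc, ← Real.exp_add]
    ring_nf
  simp only [h1]
  rw [integral_const_mul, integral_gaussian]
  have h3 : Real.pi / ((1 + c) / 2) = (2 * Real.pi) / (1 + c) := by
    field_simp
  rw [h3, Real.sqrt_div (by positivity), Real.rpow_neg (by linarith), ← Real.sqrt_eq_rpow]
  have : Real.sqrt (2 * Real.pi) ≠ 0 := by positivity
  field_simp

section Diagonalization

variable {ι : Type*} [Fintype ι] [DecidableEq ι]

lemma Matrix.IsSymm.exists_diagonalization {M : Matrix ι ι ℝ} (hM : M.IsSymm) :
    ∃ (U : Matrix ι ι ℝ) (r : ι → ℝ), Uᵀ * U = 1 ∧ U * Uᵀ = 1 ∧ M = U * diagonal r * Uᵀ := by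
  have hH : M.IsHermitian := by simpa [IsHermitian, IsSymm] using hM
  have hUU : hH.eigenvectorUnitary.1ᵀ * hH.eigenvectorUnitary.1 = 1 := by
    simpa [star_eq_conjTranspose] using (Unitary.mem_iff.1 hH.eigenvectorUnitary.2).1
  refine ⟨hH.eigenvectorUnitary.1, hH.eigenvalues, hUU, mul_eq_one_comm.1 hUU, ?_⟩
  have := hH.spectral_theorem
  simpa [Unitary.conjStarAlgAut_apply, star_eq_conjTranspose, Function.comp_def] using this

lemma Matrix.PosSemidef.nonneg_of_eq_conj {M U : Matrix ι ι ℝ} {r : ι → ℝ} (hM : M.PosSemidef)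
    (hU : Uᵀ * U = 1) (h : M = U * diagonal r * Uᵀ) (i : ι) : 0 ≤ r i := by
  have h1 := (hM.conjTranspose_mul_mul_same U).diag_nonneg (i := i)
  rw [h, conjTranspose_eq_transpose_of_trivial] at h1
  have h2 : Uᵀ * (U * diagonal r * Uᵀ) * U = diagonal r := by
    calc Uᵀ * (U * diagonal r * Uᵀ) * U = (Uᵀ * U) * diagonal r * (Uᵀ * U) := by
          simp only [mul_assoc]
      _ = _ := by rw [hU, one_mul, mul_one]
  simpa [h2] using h1

lemma Matrix.det_one_add_smul_conj {U : Matrix ι ι ℝ} (r : ι → ℝ) (hU : U * Uᵀ = 1) (c : ℝ) :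
    (1 + c • (U * diagonal r * Uᵀ)).det = ∏ i, (1 + c * r i) := by
  have : 1 + c • (U * diagonal r * Uᵀ) = U * (1 + c • diagonal r) * Uᵀ := by
    rw [mul_add, add_mul, mul_one, hU, Matrix.mul_smul, Matrix.smul_mul]
  rw [this, det_mul_right_comm, hU, one_mul, ← diagonal_one, ← diagonal_smul, diagonal_add,
    det_diagonal]
  simp

end Diagonalization

namespace IsCenteredGaussian

variable {ι : Type*} [Fintype ι] {μ : Measure (ι → ℝ)} {C : Matrix ι ι ℝ}

lemma posSemidef (h : IsCenteredGaussian μ C) (hC : C.IsSymm) : C.PosSemidef :=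
  .of_dotProduct_mulVec_nonneg (by simpa [IsHermitian, IsSymm] using hC) fun t => by
    simpa using h.quadForm_nonneg t

lemma det_pos_and_laplace [DecidableEq ι] (h : IsCenteredGaussian μ C) (hC : C.IsSymm) {k : ι → ℝ}
    (hk : ∀ i, 0 ≤ k i) :
    0 < (1 + diagonal k * C).det ∧
    ∫ x, Real.exp (-(∑ i, k i * x i ^ 2) / 2) ∂μ =
      ((1 + diagonal k * C).det) ^ (-(1 / 2) : ℝ) := by
  set S : Matrix ι ι ℝ := diagonal fun i => √(k i) with hS
  have hSt : Sᵀ = S := diagonal_transpose _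
  have hSS : diagonal k = S * S := by
    rw [hS, diagonal_mul_diagonal]
    simp [Real.mul_self_sqrt (hk _)]
  have hG := h.map_mulVec S
  rw [hSt] at hG
  have hpsd : (S * C * S).PosSemidef := hG.posSemidef (by
    rw [IsSymm, transpose_mul, transpose_mul, hSt, hC.eq, mul_assoc])
  obtain ⟨U, e, hUU, hUU', hspec⟩ := IsSymm.exists_diagonalization (M := S * C * S) (by
    rw [IsSymm, transpose_mul, transpose_mul, hSt, hC.eq, mul_assoc])
  have he0 : ∀ i, 0 ≤ e i := hpsd.nonneg_of_eq_conj hUU hspec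
  set T : Matrix ι ι ℝ := diagonal fun i => √(e i) with hT
  have hTT : T * T = diagonal e := by
    rw [hT, diagonal_mul_diagonal]
    simp [Real.mul_self_sqrt (he0 _)]
  have hstd := (std (ι := ι)).map_mulVec (U * T)
  have hlaw : μ.map (S *ᵥ ·) = (Measure.pi fun _ : ι => gaussianReal 0 1).map ((U * T) *ᵥ ·) := by
    refine hG.unique hstd fun t => ?_
    rw [hspec, transpose_mul, hT, diagonal_transpose, ← hT, mul_one, ← hTT]
    simp only [mul_assoc]
  have hdet : (1 + diagonal k * C).det = ∏ i, (1 + e i) := by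
    rw [hSS, mul_assoc, det_one_add_mul_comm, hspec]
    simpa using det_one_add_smul_conj e hUU' 1
  refine ⟨hdet ▸ Finset.prod_pos fun i _ => by linarith [he0 i], ?_⟩
  have hm : ∀ A : Matrix ι ι ℝ, Measurable (A *ᵥ ·) := fun A => by
    unfold mulVec dotProduct; fun_prop
  have hfm : ∀ ν : Measure (ι → ℝ),
      AEStronglyMeasurable (fun y : ι → ℝ => Real.exp (-(y ⬝ᵥ y) / 2)) ν := fun ν => by
    refine Measurable.aestronglyMeasurable ?_
    unfold dotProduct; fun_prop
  calc ∫ x, Real.exp (-(∑ i, k i * x i ^ 2) / 2) ∂μ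
      = ∫ y, Real.exp (-(y ⬝ᵥ y) / 2) ∂(μ.map (S *ᵥ ·)) := by
        rw [integral_map (hm S).aemeasurable (hfm _)]
        congr with x
        congr 3
        rw [dotProduct]
        refine Finset.sum_congr rfl fun i _ => ?_
        rw [hS, mulVec_diagonal, mul_mul_mul_comm, Real.mul_self_sqrt (hk i), sq]
    _ = ∫ y, ∏ i, Real.exp (-(e i * y i ^ 2) / 2) ∂(Measure.pi fun _ : ι => gaussianReal 0 1) := by
        rw [hlaw, integral_map (hm _).aemeasurable (hfm _)]
        congr with y
        rw [← Real.exp_sum, ← mulVec_mulVec, dotProduct_mulVec, ← mulVec_transpose,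
          mulVec_mulVec, hUU, one_mulVec, dotProduct, ← Finset.sum_div, Finset.sum_neg_distrib]
        congr 3
        refine Finset.sum_congr rfl fun i _ => ?_
        rw [hT, mulVec_diagonal, mul_mul_mul_comm, Real.mul_self_sqrt (he0 i), sq]
    _ = _ := by
        rw [integral_fintype_prod_eq_prod (f := fun i (y : ℝ) => Real.exp (-(e i * y ^ 2) / 2)),
          hdet, ← Real.finsetProd_rpow _ _ fun i _ => by linarith [he0 i]]
        exact Finset.prod_congr rfl fun i _ => integral_exp_neg_mul_sq_gaussianReal (he0 i)

end IsCenteredGaussian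

section BlockDet

variable {ι β : Type*} [Fintype ι] [DecidableEq ι] [DecidableEq β]

/-- The block diagonal part of a matrix for the blocks given by the fibers of `b`. -/
def blockPart (b : ι → β) (C : Matrix ι ι ℝ) : Matrix ι ι ℝ :=
  of fun i j => if b i = b j then C i j else 0

lemma Matrix.PosDef.exists_whitening {C : Matrix ι ι ℝ} (hC : C.PosDef) :
    ∃ T : Matrix ι ι ℝ, T * C * Tᵀ = 1 := by
  obtain ⟨U, e, hUU, hUU', hspec⟩ := IsSymm.exists_diagonalization (M := C)
    (by simpa [IsHermitian, IsSymm] using hC.isHermitian)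
  have he : ∀ i, 0 < e i := by
    intro i
    refine lt_of_le_of_ne (hC.posSemidef.nonneg_of_eq_conj hUU hspec i) fun h0 => ?_
    have hd := hC.det_pos
    rw [hspec, det_mul_right_comm, hUU', one_mul, det_diagonal,
      Finset.prod_eq_zero (Finset.mem_univ i) h0.symm] at hd
    exact hd.false
  refine ⟨diagonal (fun i => (√(e i))⁻¹) * Uᵀ, ?_⟩
  set T : Matrix ι ι ℝ := diagonal (fun i => (√(e i))⁻¹) * Uᵀ with hT
  have hTt : Tᵀ = U * diagonal (fun i => (√(e i))⁻¹) := by simp [hT]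
  calc T * C * Tᵀ = diagonal (fun i => (√(e i))⁻¹) * (Uᵀ * U) * diagonal e * (Uᵀ * U) *
          diagonal (fun i => (√(e i))⁻¹) := by
          rw [hTt, hT, hspec]; simp only [mul_assoc]
      _ = 1 := by
        rw [hUU, mul_one, mul_one, diagonal_mul_diagonal, diagonal_mul_diagonal, ← diagonal_one]
        congr 1
        ext i
        have h1 : √(e i) * √(e i) = e i := Real.mul_self_sqrt (he i).le
        have h2 : √(e i) ≠ 0 := (Real.sqrt_pos.2 (he i)).ne'
        nth_rw 2 [← h1]
        field_simp

omit [DecidableEq ι] in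
lemma trace_mul_inv_blockPart_aux (b : ι → β) (C V : Matrix ι ι ℝ)
    (hV : ∀ i j, b i ≠ b j → V i j = 0) : ((C - blockPart b C) * V).trace = 0 := by
  rw [trace]
  refine Finset.sum_eq_zero fun i _ => ?_
  rw [diag_apply, mul_apply]
  refine Finset.sum_eq_zero fun j _ => ?_
  by_cases h : b i = b j
  · simp [blockPart, h]
  · rw [hV j i (Ne.symm h), mul_zero]

lemma inv_blockPart_apply_eq_zero (b : ι → β) (C : Matrix ι ι ℝ)
    (hu : IsUnit (blockPart b C).det) {i j : ι} (hij : b i ≠ b j) :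
    (blockPart b C)⁻¹ i j = 0 := by
  set A := blockPart b C with hA
  set D : Matrix ι ι ℝ := diagonal fun l => if b l = b i then 1 else 0 with hD
  have hcomm : A * D = D * A := by
    ext k l
    rw [hD, mul_diagonal, diagonal_mul, hA, blockPart, of_apply]
    by_cases h : b k = b l <;> simp [h]
  have h2 : A⁻¹ * D = D * A⁻¹ := by
    calc A⁻¹ * D = A⁻¹ * D * (A * A⁻¹) := by rw [mul_nonsing_inv _ hu, mul_one]
      _ = A⁻¹ * (A * D) * A⁻¹ := by rw [hcomm]; simp only [mul_assoc]
      _ = _ := by rw [← mul_assoc A⁻¹, nonsing_inv_mul _ hu, one_mul]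
  have h3 := congrFun (congrFun h2 i) j
  rw [hD, mul_diagonal, diagonal_mul] at h3
  simpa [Ne.symm hij] using h3.symm

lemma det_interpolation_antitone_of_posDef (b : ι → β) {C : Matrix ι ι ℝ} (hC : C.PosDef)
    (hC0 : (blockPart b C).PosDef) {σ τ : ℝ} (hσ : 0 ≤ σ) (hστ : σ ≤ τ) (hτ : τ ≤ 1) :
    (blockPart b C + τ • (C - blockPart b C)).det ≤
      (blockPart b C + σ • (C - blockPart b C)).det := by
  set C₀ := blockPart b C with hC₀
  obtain ⟨T, hTC⟩ := hC0.exists_whitening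
  have hinv : Tᵀ * T = C₀⁻¹ := by
    symm
    refine inv_eq_right_inv ?_
    have h1 : T * (C₀ * Tᵀ) = 1 := by rw [← mul_assoc]; exact hTC
    have h2 := mul_eq_one_comm.1 h1
    rwa [mul_assoc] at h2
  set R := C - C₀ with hR
  have hCsym : Cᵀ = C := by simpa [IsHermitian] using hC.isHermitian
  have hC0sym : C₀ᵀ = C₀ := by simpa [IsHermitian] using hC0.isHermitian
  obtain ⟨W, r, hWW, hWW', hspecR⟩ := IsSymm.exists_diagonalization (M := T * R * Tᵀ) (by
    have hRt : Rᵀ = R := by rw [hR, transpose_sub, hCsym, hC0sym]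
    rw [IsSymm, transpose_mul, transpose_mul, transpose_transpose, hRt, mul_assoc])
  have hsum : ∑ i, r i = 0 := by
    have h1 : (T * R * Tᵀ).trace = 0 := by
      rw [trace_mul_comm, ← mul_assoc, trace_mul_comm, hinv]
      exact trace_mul_inv_blockPart_aux b C _ fun i j hij =>
        inv_blockPart_apply_eq_zero b C hC0.det_pos.ne'.isUnit hij
    rw [hspecR, trace_mul_comm, ← mul_assoc, hWW, one_mul, trace_diagonal] at h1
    exact h1
  have hr : ∀ i, 0 ≤ 1 + r i := by
    have hp : (T * C * Tᵀ).PosSemidef := by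
      simpa using hC.posSemidef.mul_mul_conjTranspose_same T
    refine hp.nonneg_of_eq_conj (r := fun i => 1 + r i) hWW ?_
    have : T * C * Tᵀ = 1 + T * R * Tᵀ := by
      rw [← hTC, hR]; noncomm_ring
    have hd : diagonal (fun i => 1 + r i) = 1 + diagonal r := by
      rw [← diagonal_one, diagonal_add]
    rw [this, hspecR, hd, mul_add, add_mul, mul_one, hWW']
  have hdet : ∀ c : ℝ, (C₀ + c • R).det * (T.det * T.det) = ∏ i, (1 + c * r i) := by
    intro c
    rw [← det_one_add_smul_conj r hWW' c, ← hspecR, ← hTC]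
    have : T * C₀ * Tᵀ + c • (T * R * Tᵀ) = T * (C₀ + c • R) * Tᵀ := by
      rw [mul_add, add_mul, Matrix.mul_smul, Matrix.smul_mul]
    rw [this, det_mul, det_mul, det_transpose, mul_comm, mul_right_comm]
  have hTpos : 0 < T.det * T.det := by
    have h1 := congrArg det hTC
    rw [det_mul, det_mul, det_transpose, det_one] at h1
    refine mul_self_pos.2 fun h0 => ?_
    simp [h0] at h1
  refine le_of_mul_le_mul_right ?_ hTpos
  rw [hdet, hdet]
  have hpos : ∀ c : ℝ, 0 ≤ c → c ≤ 1 → ∀ i, 0 ≤ 1 + c * r i := fun c h0 h1 i => by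
    nlinarith [hr i]
  calc ∏ i, (1 + τ * r i) ≤ ∏ i, ((1 + σ * r i) * Real.exp ((τ - σ) * r i)) := by
        refine Finset.prod_le_prod (fun i _ => hpos τ (hσ.trans hστ) hτ i) fun i _ => ?_
        have h1 := Real.add_one_le_exp ((τ - σ) * r i)
        have h2 := mul_le_mul_of_nonneg_left h1 (hpos σ hσ (hστ.trans hτ) i)
        nlinarith [mul_nonneg (mul_nonneg hσ (sub_nonneg.2 hστ)) (mul_self_nonneg (r i))]
    _ = ∏ i, (1 + σ * r i) := by
        rw [Finset.prod_mul_distrib, ← Real.exp_sum, ← Finset.mul_sum, hsum, mul_zero,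
          Real.exp_zero, mul_one]

lemma det_interpolation_antitone (b : ι → β) {C : Matrix ι ι ℝ} (hC : C.PosSemidef)
    (hC0 : (blockPart b C).PosSemidef) {σ τ : ℝ} (hσ : 0 ≤ σ) (hστ : σ ≤ τ) (hτ : τ ≤ 1) :
    (blockPart b C + τ • (C - blockPart b C)).det ≤
      (blockPart b C + σ • (C - blockPart b C)).det := by
  have hb : ∀ ε : ℝ, blockPart b (C + ε • 1) = blockPart b C + ε • 1 := by
    intro ε
    ext i j
    by_cases h : i = j
    · subst h; simp [blockPart]
    · simp [blockPart, one_apply, h]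
  have hcont : ∀ c : ℝ, Filter.Tendsto
      (fun ε : ℝ => (blockPart b (C + ε • 1) + c • ((C + ε • 1) - blockPart b (C + ε • 1))).det)
      (nhdsWithin 0 (Set.Ioi 0)) (nhds (blockPart b C + c • (C - blockPart b C)).det) := by
    intro c
    simp only [hb]
    have : Continuous fun ε : ℝ =>
        (blockPart b C + ε • 1 + c • (C + ε • 1 - (blockPart b C + ε • 1))).det := by
      refine Continuous.matrix_det ?_
      fun_prop
    have h2 := this.tendsto 0
    simp only [zero_smul, add_zero] at h2
    exact h2.mono_left nhdsWithin_le_nhds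
  refine le_of_tendsto_of_tendsto (hcont τ) (hcont σ) ?_
  filter_upwards [self_mem_nhdsWithin] with ε hε
  have hpd : (ε • (1 : Matrix ι ι ℝ)).PosDef := PosDef.one.smul hε
  refine det_interpolation_antitone_of_posDef b (PosDef.posSemidef_add hC hpd) ?_ hσ hστ hτ
  rw [hb]
  exact PosDef.posSemidef_add hC0 hpd

/-- The principal minor of `A` on the index set `s`, as a determinant of full size. -/
def principalMinor (s : Finset ι) (A : Matrix ι ι ℝ) : ℝ :=
  (diagonal (fun i => if i ∈ s then (1 : ℝ) else 0) * A *
    diagonal (fun i => if i ∈ s then (1 : ℝ) else 0) +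
    diagonal (fun i => if i ∈ s then (0 : ℝ) else 1)).det

lemma det_one_add_diagonal_mul (k : ι → ℝ) (A : Matrix ι ι ℝ) :
    (1 + diagonal k * A).det = ∑ s : Finset ι, (∏ i ∈ s, k i) * principalMinor s A := by
  have h1 : (1 + diagonal k * A).det =
      (detRowAlternating (n := ι) (R := ℝ)).toMultilinearMap
        ((fun i => k i • A i) + fun i => (1 : Matrix ι ι ℝ) i) := by
    change _ = det _
    congr 1
    ext i j
    simp [diagonal_mul, add_comm]
  rw [h1, MultilinearMap.map_add_univ]
  refine Finset.sum_congr rfl fun s _ => ?_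
  set P : ι → ι → ℝ := fun i j => if i ∈ s then A i j else (1 : Matrix ι ι ℝ) i j with hP
  have h2 : s.piecewise (fun i => k i • A i) (fun i => (1 : Matrix ι ι ℝ) i) =
      s.piecewise (fun i => k i • P i) P := by
    funext i j
    by_cases h : i ∈ s <;> simp [Finset.piecewise, h, hP]
  rw [h2, MultilinearMap.map_piecewise_smul, smul_eq_mul]
  congr 1
  change det (of P) = _
  set S : Matrix ι ι ℝ := diagonal (fun i => if i ∈ s then (1 : ℝ) else 0) with hS
  have hSS : S * S = S := by
    rw [hS, diagonal_mul_diagonal]; congr 1; ext i; simp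
  have hS' : diagonal (fun i => if i ∈ s then (0 : ℝ) else 1) = 1 - S := by
    rw [hS, ← diagonal_one, diagonal_sub]; congr 1; ext i; by_cases h : i ∈ s <;> simp [h]
  have h3 : of P = 1 + S * (S * (A - 1)) := by
    rw [← mul_assoc, hSS]
    ext i j
    rw [hS, of_apply, Matrix.add_apply, diagonal_mul]
    by_cases h : i ∈ s <;> simp [hP, h]
  rw [h3, det_one_add_mul_comm, principalMinor, hS', mul_sub, sub_mul, mul_one, hSS]
  congr 1
  abel

lemma principalMinor_interpolation_antitone (b : ι → β) {C : Matrix ι ι ℝ} (hC : C.PosSemidef)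
    (hC0 : (blockPart b C).PosSemidef) (s : Finset ι) {σ τ : ℝ} (hσ : 0 ≤ σ) (hστ : σ ≤ τ)
    (hτ : τ ≤ 1) :
    principalMinor s (blockPart b C + τ • (C - blockPart b C)) ≤
      principalMinor s (blockPart b C + σ • (C - blockPart b C)) := by
  set S : Matrix ι ι ℝ := diagonal (fun i => if i ∈ s then (1 : ℝ) else 0) with hS
  set S' : Matrix ι ι ℝ := diagonal (fun i => if i ∈ s then (0 : ℝ) else 1) with hS'
  have hSp : S'.PosSemidef := PosSemidef.diagonal fun i => by
    by_cases h : i ∈ s <;> simp [h]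
  have hSt : Sᴴ = S := by simp [hS]
  have hpsd : ∀ A : Matrix ι ι ℝ, A.PosSemidef → (S * A * S + S').PosSemidef := fun A hA => by
    have := hA.mul_mul_conjTranspose_same S
    rw [hSt] at this
    exact this.add hSp
  have hb : blockPart b (S * C * S + S') = S * blockPart b C * S + S' := by
    ext i j
    rcases eq_or_ne i j with rfl | h
    · simp [blockPart, hS, hS']
    · by_cases hb : b i = b j <;> simp [blockPart, hS, hS', h, hb]
  have key := det_interpolation_antitone b (hpsd C hC) (hb ▸ hpsd _ hC0) hσ hστ hτ
  have e : ∀ c : ℝ, principalMinor s (blockPart b C + c • (C - blockPart b C)) =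
      (blockPart b (S * C * S + S') + c • ((S * C * S + S') - blockPart b (S * C * S + S'))).det := by
    intro c
    rw [hb, principalMinor]
    congr 1
    rw [add_sub_add_right_eq_sub, ← sub_mul, ← mul_sub, mul_add, add_mul, Matrix.mul_smul,
      Matrix.smul_mul]
    abel
  rw [e, e]
  exact key

end BlockDet

section Royen

variable {ι : Type*} [Fintype ι] [DecidableEq ι]

lemma prod_sum_exp_pow (c : ι → ℕ → ℝ) (N : ℕ) (q : ι → ℝ) :
    ∏ i, ∑ n ∈ Finset.range N, c i n * Real.exp (-q i / 2) ^ n =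
      ∑ k ∈ Fintype.piFinset fun _ : ι => Finset.range N,
        (∏ i, c i (k i)) * Real.exp (-(∑ i, (k i : ℝ) * q i) / 2) := by
  rw [Finset.prod_univ_sum]
  refine Finset.sum_congr rfl fun k _ => ?_
  rw [Finset.prod_mul_distrib]
  congr 1
  simp only [← Real.exp_nat_mul]
  rw [← Real.exp_sum]
  congr 1
  rw [neg_div, Finset.sum_div, ← Finset.sum_neg_distrib]
  exact Finset.sum_congr rfl fun i _ => by ring

omit [DecidableEq ι] in
lemma integrable_exp_neg_sum {Ω : Type*} [MeasurableSpace Ω] {μ : Measure Ω} [IsFiniteMeasure μ]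
    {k : ι → ℝ} (hk : ∀ i, 0 ≤ k i) {q : Ω → ι → ℝ} (hq : Measurable q)
    (hq0 : ∀ x i, 0 ≤ q x i) :
    Integrable (fun x => Real.exp (-(∑ i, k i * q x i) / 2)) μ := by
  refine Integrable.of_bound (C := 1) (Measurable.aestronglyMeasurable (by fun_prop)) ?_
  refine .of_forall fun x => ?_
  rw [Real.norm_eq_abs, Real.abs_exp, Real.exp_le_one_iff]
  have : 0 ≤ ∑ i, k i * q x i := Finset.sum_nonneg fun i _ => mul_nonneg (hk i) (hq0 x i)
  linarith

lemma integral_prod_sum_exp_pow {Ω : Type*} [MeasurableSpace Ω] {μ : Measure Ω}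
    [IsFiniteMeasure μ] (c : ι → ℕ → ℝ) (N : ℕ) {q : Ω → ι → ℝ} (hq : Measurable q)
    (hq0 : ∀ x i, 0 ≤ q x i) :
    ∫ x, ∏ i, ∑ n ∈ Finset.range N, c i n * Real.exp (-q x i / 2) ^ n ∂μ =
      ∑ k ∈ Fintype.piFinset fun _ : ι => Finset.range N,
        (∏ i, c i (k i)) * ∫ x, Real.exp (-(∑ i, (k i : ℝ) * q x i) / 2) ∂μ := by
  simp only [prod_sum_exp_pow]
  rw [integral_finsetSum]
  · simp only [integral_const_mul]
  · exact fun k _ => (integrable_exp_neg_sum (fun i => Nat.cast_nonneg _) hq hq0).const_mul _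

lemma sum_mul_laplace_pow_three_nonneg (μ : Measure (ι → ℝ)) [IsProbabilityMeasure μ]
    (c : ι → ℕ → ℝ) (N : ℕ)
    (hc : ∀ i, ∀ y ∈ Set.Icc (0 : ℝ) 1, 0 ≤ ∑ n ∈ Finset.range N, c i n * y ^ n) :
    0 ≤ ∑ k ∈ Fintype.piFinset fun _ : ι => Finset.range N,
        (∏ i, c i (k i)) * (∫ x, Real.exp (-(∑ i, (k i : ℝ) * x i ^ 2) / 2) ∂μ) ^ 3 := by
  have h1 : ∀ k : ι → ℕ, (∫ x, Real.exp (-(∑ i, (k i : ℝ) * x i ^ 2) / 2) ∂μ) ^ 3 =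
      ∫ z, Real.exp (-(∑ i, (k i : ℝ) * ∑ j, z j i ^ 2) / 2)
        ∂(Measure.pi fun _ : Fin 3 => μ) := by
    intro k
    have := integral_fintype_prod_eq_pow (ι := Fin 3) (μ := μ)
      (fun x : ι → ℝ => Real.exp (-(∑ i, (k i : ℝ) * x i ^ 2) / 2))
    rw [Fintype.card_fin] at this
    rw [← this]
    congr with z
    rw [← Real.exp_sum]
    congr 1
    simp only [Finset.mul_sum]
    rw [Finset.sum_comm, ← Finset.sum_div, Finset.sum_neg_distrib]
  simp only [h1]
  rw [← integral_prod_sum_exp_pow c N (q := fun (z : Fin 3 → ι → ℝ) i => ∑ j, z j i ^ 2)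
    (by fun_prop) (fun z i => Finset.sum_nonneg fun j _ => sq_nonneg _)]
  refine integral_nonneg fun z => Finset.prod_nonneg fun i _ => hc i _ ⟨(Real.exp_pos _).le, ?_⟩
  rw [Real.exp_le_one_iff]
  have : 0 ≤ ∑ j, z j i ^ 2 := Finset.sum_nonneg fun j _ => sq_nonneg _
  linarith

namespace IsCenteredGaussian

variable {β : Type*} [DecidableEq β] {b : ι → β} {C : Matrix ι ι ℝ} {μ μ₀ : Measure (ι → ℝ)}

omit [DecidableEq ι] in
lemma interpolation (hμ : IsCenteredGaussian μ C) (hμ₀ : IsCenteredGaussian μ₀ (blockPart b C))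
    {τ : ℝ} (h0 : 0 ≤ τ) (h1 : τ ≤ 1) :
    IsCenteredGaussian ((μ.prod μ₀).map fun z i => √τ * z.1 i + √(1 - τ) * z.2 i)
      (blockPart b C + τ • (C - blockPart b C)) := by
  refine hμ.map_prod hμ₀ (by fun_prop) (fun t => √τ • t) (fun t => √(1 - τ) • t)
    (fun t z => ?_) fun t => ?_
  · simp only [dotProduct, Pi.smul_apply, smul_eq_mul]
    rw [← Finset.sum_add_distrib]
    exact Finset.sum_congr rfl fun i _ => by ring
  · simp only [mulVec_smul, dotProduct_smul, smul_dotProduct, smul_eq_mul, ← mul_assoc,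
      Real.mul_self_sqrt h0, Real.mul_self_sqrt (sub_nonneg.2 h1), add_mulVec, smul_mulVec,
      sub_mulVec, dotProduct_add, dotProduct_sub]
    ring

omit [Fintype ι] [DecidableEq ι] in
lemma _root_.blockPart_isSymm (b : ι → β) {C : Matrix ι ι ℝ} (hC : C.IsSymm) :
    (blockPart b C).IsSymm := by
  ext i j
  simp [blockPart, hC.apply j i, eq_comm]

/-- Royen's monotonicity argument for products of polynomials in `exp (-xᵢ² / 2)`. -/
lemma integral_prod_poly_blockPart_le (hμ : IsCenteredGaussian μ C)
    (hμ₀ : IsCenteredGaussian μ₀ (blockPart b C)) (hC : C.IsSymm) (c : ι → ℕ → ℝ) (N : ℕ)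
    (hc : ∀ i, ∀ y ∈ Set.Icc (0 : ℝ) 1, 0 ≤ ∑ n ∈ Finset.range N, c i n * y ^ n)
    (hc' : ∀ i, ∀ y ∈ Set.Icc (0 : ℝ) 1, 0 ≤ ∑ n ∈ Finset.range N, (n * c i n) * y ^ n) :
    ∫ x, ∏ i, ∑ n ∈ Finset.range N, c i n * Real.exp (-x i ^ 2 / 2) ^ n ∂μ₀ ≤
      ∫ x, ∏ i, ∑ n ∈ Finset.range N, c i n * Real.exp (-x i ^ 2 / 2) ^ n ∂μ := by
  have := hμ.prob
  have := hμ₀.prob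
  set A : ℝ → Matrix ι ι ℝ := fun τ => blockPart b C + τ • (C - blockPart b C) with hA
  have hC0 : (blockPart b C).IsSymm := blockPart_isSymm b hC
  have hAs : ∀ τ, (A τ).IsSymm := fun τ => hC0.add ((hC.sub hC0).smul τ)
  set D : (ι → ℕ) → ℝ → ℝ := fun k τ => (1 + diagonal (fun i => (k i : ℝ)) * A τ).det with hD
  set m : Finset ι → ℝ → ℝ := fun s τ => principalMinor s (A τ) with hm
  have hDm : ∀ k τ, D k τ = ∑ s, (∏ i ∈ s, (k i : ℝ)) * m s τ := fun k τ =>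
    det_one_add_diagonal_mul _ _
  have hmd : ∀ s, Differentiable ℝ (m s) := by
    intro s
    simp only [hm, principalMinor, hA, det_apply', Matrix.add_apply, diagonal_mul, mul_diagonal,
      Matrix.smul_apply]
    fun_prop
  have hm' : ∀ s, ∀ τ ∈ Set.Ioo (0 : ℝ) 1, deriv (m s) τ ≤ 0 := by
    intro s τ hτ
    have h1 : AntitoneOn (m s) (Set.Icc 0 1) := fun σ hσ τ hτ h =>
      principalMinor_interpolation_antitone b (hμ.posSemidef hC) (hμ₀.posSemidef hC0) s hσ.1 h hτ.2
    have := h1.derivWithin_nonpos (x := τ)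
    rwa [derivWithin_of_mem_nhds (Icc_mem_nhds hτ.1 hτ.2)] at this
  have hlap : ∀ τ ∈ Set.Icc (0 : ℝ) 1, ∃ ν : Measure (ι → ℝ), IsCenteredGaussian ν (A τ) :=
    fun τ hτ => ⟨_, hμ.interpolation hμ₀ hτ.1 hτ.2⟩
  have hDpos : ∀ k, ∀ τ ∈ Set.Icc (0 : ℝ) 1, 0 < D k τ := fun k τ hτ => by
    obtain ⟨ν, hν⟩ := hlap τ hτ
    exact (hν.det_pos_and_laplace (hAs τ) fun i => Nat.cast_nonneg (k i)).1
  have hint : ∀ τ, ∀ ν : Measure (ι → ℝ), IsCenteredGaussian ν (A τ) →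
      ∫ x, ∏ i, ∑ n ∈ Finset.range N, c i n * Real.exp (-x i ^ 2 / 2) ^ n ∂ν =
        ∑ k ∈ Fintype.piFinset fun _ : ι => Finset.range N,
          (∏ i, c i (k i)) * D k τ ^ (-(1 / 2) : ℝ) := by
    intro τ ν hν
    have := hν.prob
    rw [integral_prod_sum_exp_pow c N (q := fun (x : ι → ℝ) i => x i ^ 2) (by fun_prop)
      fun x i => sq_nonneg _]
    refine Finset.sum_congr rfl fun k _ => ?_
    rw [(hν.det_pos_and_laplace (hAs τ) fun i => Nat.cast_nonneg (k i)).2]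
  rw [hint 0 μ₀ (by simpa [hA] using hμ₀), hint 1 μ (by simpa [hA] using hμ)]
  set F : ℝ → ℝ := fun τ => ∑ k ∈ Fintype.piFinset fun _ : ι => Finset.range N,
          (∏ i, c i (k i)) * D k τ ^ (-(1 / 2) : ℝ) with hF
  have hderiv : ∀ τ ∈ Set.Icc (0 : ℝ) 1, HasDerivAt F
      (∑ k ∈ Fintype.piFinset fun _ : ι => Finset.range N, (∏ i, c i (k i)) *
        ((∑ s, (∏ i ∈ s, (k i : ℝ)) * deriv (m s) τ) * (-(1 / 2) : ℝ) *
          D k τ ^ (-(1 / 2) - 1 : ℝ))) τ := by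
    intro τ hτ
    refine HasDerivAt.fun_sum fun k _ => HasDerivAt.const_mul _ ?_
    refine HasDerivAt.rpow_const ?_ (Or.inl (hDpos k τ hτ).ne')
    rw [show D k = fun τ => ∑ s, (∏ i ∈ s, (k i : ℝ)) * m s τ from funext (hDm k)]
    exact HasDerivAt.fun_sum fun s _ => ((hmd s τ).hasDerivAt).const_mul _
  have hmono : MonotoneOn F (Set.Icc 0 1) := by
    refine monotoneOn_of_deriv_nonneg (convex_Icc 0 1)
      (fun τ hτ => (hderiv τ hτ).continuousAt.continuousWithinAt)
      (fun τ hτ => (hderiv τ (interior_subset hτ)).differentiableAt.differentiableWithinAt) ?_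
    intro τ hτ
    have hτ' := interior_subset hτ
    rw [interior_Icc] at hτ
    rw [(hderiv τ hτ').deriv]
    obtain ⟨ν, hν⟩ := hlap τ hτ'
    have := hν.prob
    have hpow : ∀ k : ι → ℕ, D k τ ^ (-(1 / 2) - 1 : ℝ) =
        (∫ x, Real.exp (-(∑ i, (k i : ℝ) * x i ^ 2) / 2) ∂ν) ^ 3 := by
      intro k
      rw [(hν.det_pos_and_laplace (hAs τ) fun i => Nat.cast_nonneg (k i)).2,
        ← Real.rpow_natCast, ← Real.rpow_mul (hDpos k τ hτ').le]
      norm_num [hD]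
    have hrw : (∑ k ∈ Fintype.piFinset fun _ : ι => Finset.range N, (∏ i, c i (k i)) *
        ((∑ s, (∏ i ∈ s, (k i : ℝ)) * deriv (m s) τ) * (-(1 / 2) : ℝ) *
          D k τ ^ (-(1 / 2) - 1 : ℝ))) =
        ∑ s, (-(1 / 2) * deriv (m s) τ) *
          ∑ k ∈ Fintype.piFinset fun _ : ι => Finset.range N,
            (∏ i, if i ∈ s then (k i : ℝ) * c i (k i) else c i (k i)) *
            (∫ x, Real.exp (-(∑ i, (k i : ℝ) * x i ^ 2) / 2) ∂ν) ^ 3 := by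
      simp only [Finset.mul_sum, Finset.sum_mul]
      rw [Finset.sum_comm]
      refine Finset.sum_congr rfl fun s _ => Finset.sum_congr rfl fun k _ => ?_
      rw [← hpow]
      have : (∏ i, if i ∈ s then (k i : ℝ) * c i (k i) else c i (k i)) =
          (∏ i ∈ s, (k i : ℝ)) * ∏ i, c i (k i) := by
        rw [← Finset.prod_ite_mem_eq s, ← Finset.prod_mul_distrib]
        refine Finset.prod_congr rfl fun i _ => ?_
        split_ifs <;> simp
      rw [this]
      ring
    rw [hrw]
    refine Finset.sum_nonneg fun s _ => mul_nonneg (by linarith [hm' s τ hτ]) ?_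
    refine sum_mul_laplace_pow_three_nonneg ν
      (fun i n => if i ∈ s then (n : ℝ) * c i n else c i n) N fun i y hy => ?_
    by_cases h : i ∈ s
    · simpa [h] using hc' i y hy
    · simpa [h] using hc i y hy
  exact hmono (by simp) (by simp) zero_le_one

end IsCenteredGaussian

end Royen

section Slabs

open Filter Topology Polynomial

lemma tendsto_one_sub_one_sub_pow_pow {y₀ y : ℝ} (h₀ : 0 < y₀) (h₁ : y₀ ≤ 1)
    (hy : y ∈ Set.Icc (0 : ℝ) 1) :
    Tendsto (fun n : ℕ => 1 - (1 - y ^ n) ^ (n * ⌈(y₀ ^ n)⁻¹⌉₊)) atTop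
      (𝓝 (if y₀ ≤ y then 1 else 0)) := by
  have hpow : ∀ n : ℕ, y ^ n ≤ 1 := fun n => pow_le_one₀ hy.1 hy.2
  have hpow0 : ∀ n : ℕ, 0 ≤ y ^ n := fun n => pow_nonneg hy.1 n
  split_ifs with h
  · have : Tendsto (fun n : ℕ => (1 - y ^ n) ^ (n * ⌈(y₀ ^ n)⁻¹⌉₊)) atTop (𝓝 0) := by
      refine squeeze_zero (fun n => pow_nonneg (sub_nonneg.2 (hpow n)) _) (fun n => ?_)
        (Real.tendsto_exp_neg_atTop_nhds_zero.comp tendsto_natCast_atTop_atTop)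
      refine (pow_le_pow_left₀ (sub_nonneg.2 (hpow n)) (Real.one_sub_le_exp_neg _) _).trans ?_
      rw [← Real.exp_nat_mul]
      refine Real.exp_le_exp.2 ?_
      have h2 : (1 : ℝ) ≤ ⌈(y₀ ^ n)⁻¹⌉₊ * y ^ n :=
        calc (1 : ℝ) = (y₀ ^ n)⁻¹ * y₀ ^ n := (inv_mul_cancel₀ (pow_pos h₀ n).ne').symm
          _ ≤ ⌈(y₀ ^ n)⁻¹⌉₊ * y ^ n := by
            gcongr
            exact Nat.le_ceil _
      push_cast
      nlinarith [(Nat.cast_nonneg n : (0 : ℝ) ≤ n)]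
    simpa using this.const_sub 1
  · push Not at h
    have hlt : y < 1 := h.trans_le h₁
    have hr : y / y₀ < 1 := (div_lt_one h₀).2 h
    have hr0 : 0 ≤ y / y₀ := div_nonneg hy.1 h₀.le
    refine squeeze_zero (g := fun n : ℕ => n * (y / y₀) ^ n + n * y ^ n)
      (fun n => sub_nonneg.2 (pow_le_one₀ (sub_nonneg.2 (hpow n)) (by linarith [hpow0 n])))
      (fun n => ?_) ?_
    · have h1 := one_add_mul_le_pow (a := -y ^ n) (by linarith [hpow n])
        (n * ⌈(y₀ ^ n)⁻¹⌉₊)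
      have h2 : (⌈(y₀ ^ n)⁻¹⌉₊ : ℝ) ≤ (y₀ ^ n)⁻¹ + 1 :=
        (Nat.ceil_lt_add_one (by positivity)).le
      have h3 : (n : ℝ) * ⌈(y₀ ^ n)⁻¹⌉₊ * y ^ n ≤ n * ((y₀ ^ n)⁻¹ + 1) * y ^ n := by
        gcongr
        exact hpow0 n
      have h4 : (n : ℝ) * ((y₀ ^ n)⁻¹ + 1) * y ^ n = n * (y / y₀) ^ n + n * y ^ n := by
        rw [div_pow]
        field_simp
      push_cast at h1
      rw [← sub_eq_add_neg] at h1
      linarith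
    · simpa using (tendsto_self_mul_const_pow_of_lt_one hr0 hr).add
        (tendsto_self_mul_const_pow_of_lt_one hy.1 hlt)

namespace IsCenteredGaussian

variable {ι β : Type*} [Fintype ι] [DecidableEq ι] [DecidableEq β] {b : ι → β}
  {C : Matrix ι ι ℝ} {μ μ₀ : Measure (ι → ℝ)}

lemma integral_prod_eval_blockPart_le (hμ : IsCenteredGaussian μ C)
    (hμ₀ : IsCenteredGaussian μ₀ (blockPart b C)) (hC : C.IsSymm) (P : ι → ℝ[X])
    (hP : ∀ i, ∀ y ∈ Set.Icc (0 : ℝ) 1, 0 ≤ (P i).eval y)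
    (hP' : ∀ i, ∀ y ∈ Set.Icc (0 : ℝ) 1, 0 ≤ (P i).derivative.eval y) :
    ∫ x, ∏ i, (P i).eval (Real.exp (-x i ^ 2 / 2)) ∂μ₀ ≤
      ∫ x, ∏ i, (P i).eval (Real.exp (-x i ^ 2 / 2)) ∂μ := by
  set N := (Finset.univ.sup fun i => (P i).natDegree) + 2 with hN
  have hdeg : ∀ i, (P i).natDegree + 1 < N := fun i => by
    have := Finset.le_sup (f := fun i => (P i).natDegree) (Finset.mem_univ i)
    omega
  have h1 : ∀ i y, (P i).eval y = ∑ n ∈ Finset.range N, (P i).coeff n * y ^ n := fun i y =>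
    eval_eq_sum_range' (by have := hdeg i; omega) y
  have h2 : ∀ i y, y * (P i).derivative.eval y =
      ∑ n ∈ Finset.range N, (n * (P i).coeff n) * y ^ n := by
    intro i y
    have hlt : (X * (P i).derivative).natDegree < N := by
      have h3 := natDegree_mul_le (p := X) (q := (P i).derivative)
      have h4 := natDegree_derivative_le (P i)
      have h5 := natDegree_X_le (R := ℝ)
      have := hdeg i
      omega
    have := eval_eq_sum_range' hlt y
    rw [eval_mul, eval_X] at this
    rw [this]
    refine Finset.sum_congr rfl fun n _ => ?_
    cases n with
    | zero => simp
    | succ n =>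
      rw [coeff_X_mul, coeff_derivative]
      push_cast
      ring
  simp only [h1]
  refine hμ.integral_prod_poly_blockPart_le hμ₀ hC _ N (fun i y hy => h1 i y ▸ hP i y hy)
    fun i y hy => h2 i y ▸ mul_nonneg hy.1 (hP' i y hy)

/-- The Gaussian correlation inequality for symmetric slabs grouped into blocks. -/
lemma measure_slab_blockPart_le (hμ : IsCenteredGaussian μ C)
    (hμ₀ : IsCenteredGaussian μ₀ (blockPart b C)) (hC : C.IsSymm) (s : ι → ℝ) :
    μ₀ {x | ∀ i, |x i| ≤ s i} ≤ μ {x | ∀ i, |x i| ≤ s i} := by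
  by_cases hs : ∀ i, 0 ≤ s i
  swap
  · push Not at hs
    obtain ⟨i, hi⟩ := hs
    have : {x : ι → ℝ | ∀ i, |x i| ≤ s i} = ∅ := by
      ext x
      simp only [Set.mem_ofPred_eq, Set.mem_empty_iff_false, iff_false]
      exact fun h => absurd (h i) (not_le.2 (hi.trans_le (abs_nonneg _)))
    simp [this]
  have := hμ.prob
  have := hμ₀.prob
  set y₀ : ι → ℝ := fun i => Real.exp (-s i ^ 2 / 2) with hy₀
  have hy₀1 : ∀ i, y₀ i ≤ 1 := fun i => by
    rw [hy₀, Real.exp_le_one_iff]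
    linarith [sq_nonneg (s i)]
  have hmem : ∀ x : ℝ, Real.exp (-x ^ 2 / 2) ∈ Set.Icc (0 : ℝ) 1 := fun x =>
    ⟨(Real.exp_pos _).le, by rw [Real.exp_le_one_iff]; linarith [sq_nonneg x]⟩
  set P : ℕ → ι → ℝ[X] := fun n i => 1 - (1 - X ^ n) ^ (n * ⌈(y₀ i ^ n)⁻¹⌉₊) with hPdef
  have heval : ∀ n i y, (P n i).eval y = 1 - (1 - y ^ n) ^ (n * ⌈(y₀ i ^ n)⁻¹⌉₊) := fun n i y => by
    simp [hPdef]
  have hbd : ∀ n i, ∀ y ∈ Set.Icc (0 : ℝ) 1, (P n i).eval y ∈ Set.Icc (0 : ℝ) 1 := by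
    intro n i y hy
    have h1 : 0 ≤ 1 - y ^ n := sub_nonneg.2 (pow_le_one₀ hy.1 hy.2)
    rw [heval]
    exact ⟨sub_nonneg.2 (pow_le_one₀ h1 (by linarith [pow_nonneg hy.1 n])),
      by linarith [pow_nonneg h1 (n * ⌈(y₀ i ^ n)⁻¹⌉₊)]⟩
  have hderiv : ∀ n i, ∀ y ∈ Set.Icc (0 : ℝ) 1, 0 ≤ (P n i).derivative.eval y := by
    intro n i y hy
    have h1 : 0 ≤ 1 - y ^ n := sub_nonneg.2 (pow_le_one₀ hy.1 hy.2)
    have h2 : (P n i).derivative.eval y = ((n * ⌈(y₀ i ^ n)⁻¹⌉₊ : ℕ) : ℝ) *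
        (1 - y ^ n) ^ (n * ⌈(y₀ i ^ n)⁻¹⌉₊ - 1) * (n * y ^ (n - 1)) := by
      simp [hPdef, derivative_pow]
    rw [h2]
    exact mul_nonneg (mul_nonneg (Nat.cast_nonneg _) (pow_nonneg h1 _))
      (mul_nonneg (Nat.cast_nonneg _) (pow_nonneg hy.1 _))
  have hslab : ∀ (x : ι → ℝ),
      ∏ i, (if y₀ i ≤ Real.exp (-x i ^ 2 / 2) then (1 : ℝ) else 0) =
        Set.indicator {x : ι → ℝ | ∀ i, |x i| ≤ s i} 1 x := by
    intro x
    have h1 : ∀ i, y₀ i ≤ Real.exp (-x i ^ 2 / 2) ↔ |x i| ≤ s i := fun i => by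
      rw [hy₀, Real.exp_le_exp, ← abs_of_nonneg (hs i), ← sq_le_sq, abs_of_nonneg (hs i)]
      constructor <;> intro h <;> linarith
    simp only [h1, Finset.prod_ite_zero, Finset.prod_const_one]
    simp [Set.indicator_apply]
  have hmeas : MeasurableSet {x : ι → ℝ | ∀ i, |x i| ≤ s i} := by
    simp only [Set.ofPred_forall]
    exact MeasurableSet.iInter fun i =>
      measurableSet_le (measurable_pi_apply i).abs measurable_const
  have hlim : ∀ (ν : Measure (ι → ℝ)) [IsProbabilityMeasure ν],
      Tendsto (fun n => ∫ x, ∏ i, (P n i).eval (Real.exp (-x i ^ 2 / 2)) ∂ν) atTop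
        (𝓝 (ν.real {x | ∀ i, |x i| ≤ s i})) := by
    intro ν _
    rw [← integral_indicator_one hmeas]
    refine tendsto_integral_of_dominated_convergence (fun _ => 1) (fun n => ?_)
      (integrable_const _) (fun n => .of_forall fun x => ?_) (.of_forall fun x => ?_)
    · refine Measurable.aestronglyMeasurable (Finset.measurable_prod _ fun i _ => ?_)
      exact (P n i).continuous.measurable.comp (by fun_prop)
    · rw [Real.norm_eq_abs, abs_of_nonneg (Finset.prod_nonneg fun i _ => (hbd n i _ (hmem _)).1)]
      exact Finset.prod_le_one (fun i _ => (hbd n i _ (hmem _)).1)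
        fun i _ => (hbd n i _ (hmem _)).2
    · rw [← hslab]
      refine tendsto_finsetProd _ fun i _ => ?_
      simp only [heval]
      exact tendsto_one_sub_one_sub_pow_pow (Real.exp_pos _) (hy₀1 i) (hmem _)
  have hle := le_of_tendsto_of_tendsto' (hlim μ₀) (hlim μ) fun n =>
    hμ.integral_prod_eval_blockPart_le hμ₀ hC (P n) (fun i y hy => (hbd n i y hy).1) (hderiv n)
  exact (ENNReal.toReal_le_toReal (measure_ne_top _ _) (measure_ne_top _ _)).1 hle

end IsCenteredGaussian

end Slabs

section Doubling

variable {ι κ β : Type*} [Fintype ι] [Fintype κ] [DecidableEq β]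

/-- The pair of scaled sum and difference of two vectors. -/
def rotatePair (z : (κ → ℝ) × (κ → ℝ)) (p : κ × Bool) : ℝ :=
  (√2)⁻¹ * (z.1 p.1 + cond p.2 1 (-1) * z.2 p.1)

omit [Fintype κ] in
lemma measurable_rotatePair : Measurable (rotatePair (κ := κ)) := by
  unfold rotatePair
  fun_prop

lemma dotProduct_rotatePair (t : κ × Bool → ℝ) (z : (κ → ℝ) × (κ → ℝ)) :
    t ⬝ᵥ rotatePair z =
      ((√2)⁻¹ • ((fun j => t (j, true)) + fun j => t (j, false))) ⬝ᵥ z.1 +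
        ((√2)⁻¹ • ((fun j => t (j, true)) - fun j => t (j, false))) ⬝ᵥ z.2 := by
  simp only [dotProduct, rotatePair, Fintype.sum_prod_type, Fintype.sum_bool, Pi.smul_apply,
    Pi.add_apply, Pi.sub_apply, smul_eq_mul, cond_true, cond_false]
  rw [← Finset.sum_add_distrib]
  exact Finset.sum_congr rfl fun j _ => by ring

/-- Two independent copies of the covariance matrix `C`. -/
def twoCopies (C : Matrix κ κ ℝ) : Matrix (κ × Bool) (κ × Bool) ℝ :=
  of fun p q => if p.2 = q.2 then C p.1 q.1 else 0

lemma twoCopies_quadForm (C : Matrix κ κ ℝ) (t : κ × Bool → ℝ) :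
    t ⬝ᵥ twoCopies C *ᵥ t =
      (fun j => t (j, true)) ⬝ᵥ C *ᵥ (fun j => t (j, true)) +
        (fun j => t (j, false)) ⬝ᵥ C *ᵥ (fun j => t (j, false)) := by
  simp only [dotProduct, mulVec, twoCopies, of_apply, Fintype.sum_prod_type, Fintype.sum_bool]
  simp [Finset.sum_add_distrib]

lemma smul_add_sub_quadForm (C : Matrix κ κ ℝ) (u v : κ → ℝ) :
    ((√2)⁻¹ • (u + v)) ⬝ᵥ C *ᵥ ((√2)⁻¹ • (u + v)) +
      ((√2)⁻¹ • (u - v)) ⬝ᵥ C *ᵥ ((√2)⁻¹ • (u - v)) = u ⬝ᵥ C *ᵥ u + v ⬝ᵥ C *ᵥ v := by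
  have h : (√2)⁻¹ * (√2)⁻¹ = (1 / 2 : ℝ) := by
    rw [← mul_inv, Real.mul_self_sqrt (by norm_num)]
    norm_num
  simp only [mulVec_smul, smul_dotProduct, dotProduct_smul, smul_eq_mul,
    mulVec_add, mulVec_sub, add_dotProduct, sub_dotProduct, dotProduct_add, dotProduct_sub]
  linear_combination 2 * (u ⬝ᵥ C *ᵥ u + v ⬝ᵥ C *ᵥ v) * h

omit [Fintype κ] in
lemma measurableSet_forall_le [Countable κ] (t : κ → ℝ) :
    MeasurableSet {x : κ → ℝ | ∀ j, x j ≤ t j} := by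
  simp only [Set.ofPred_forall]
  exact MeasurableSet.iInter fun j => measurableSet_le (measurable_pi_apply j) measurable_const

namespace IsCenteredGaussian

/-- The doubling step: replacing one of two independent copies by its block diagonal version. -/
lemma measure_rotatePair_le [DecidableEq κ] {b : κ → β} {C : Matrix κ κ ℝ} {μ μ₀ : Measure (κ → ℝ)}
    (hμ : IsCenteredGaussian μ C) (hμ₀ : IsCenteredGaussian μ₀ (blockPart b C)) (hC : C.IsSymm)
    (t : κ → ℝ) :
    (μ.prod μ₀).map rotatePair {w | ∀ p, w p ≤ t p.1} ≤ μ {x | ∀ j, x j ≤ t j} ^ 2 := by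
  have := hμ.prob
  have := hμ₀.prob
  have hset : MeasurableSet {w : κ × Bool → ℝ | ∀ p, w p ≤ t p.1} := measurableSet_forall_le _
  have hpre : ∀ u : κ → ℝ, Prod.mk u ⁻¹' (rotatePair ⁻¹' {w | ∀ p : κ × Bool, w p ≤ t p.1}) =
      {v : κ → ℝ | ∀ j, |v j| ≤ √2 * t j - u j} := by
    intro u
    ext v
    have h2 : 0 < √2 := by positivity
    simp only [Set.mem_preimage, Set.mem_ofPred_eq, rotatePair, Prod.forall, Bool.forall_bool,
      cond_false, cond_true, abs_le', inv_mul_le_iff₀ h2]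
    refine forall_congr' fun j => ⟨fun h => ⟨by linarith [h.2], by linarith [h.1]⟩,
      fun h => ⟨by linarith [h.2], by linarith [h.1]⟩⟩
  set g : (κ → ℝ) × (κ → ℝ) → κ × Bool → ℝ := fun z p => cond p.2 (z.1 p.1) (z.2 p.1) with hg
  have hgm : Measurable g := by
    refine measurable_pi_lambda _ fun p => ?_
    rcases p with ⟨j, _ | _⟩ <;> simp only [hg, cond_true, cond_false] <;> fun_prop
  have h1 : IsCenteredGaussian ((μ.prod μ).map rotatePair) (twoCopies C) :=
    hμ.map_prod hμ measurable_rotatePair _ _ dotProduct_rotatePair fun t => by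
      rw [smul_add_sub_quadForm, twoCopies_quadForm]
  have h2 : IsCenteredGaussian ((μ.prod μ).map g) (twoCopies C) := by
    refine hμ.map_prod hμ hgm (fun t j => t (j, true)) (fun t j => t (j, false))
      (fun t z => ?_) fun t => (twoCopies_quadForm C t).symm
    simp only [dotProduct, hg, Fintype.sum_prod_type, Fintype.sum_bool, cond_true, cond_false,
      Finset.sum_add_distrib]
  have h3 : (μ.prod μ).map rotatePair {w | ∀ p, w p ≤ t p.1} = μ {x | ∀ j, x j ≤ t j} ^ 2 := by
    rw [h1.unique h2 fun _ => rfl, Measure.map_apply hgm hset, sq, ← Measure.prod_prod]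
    congr 1
    ext z
    simp only [hg, Set.mem_preimage, Set.mem_ofPred_eq, Prod.forall, Bool.forall_bool, cond_false,
      cond_true, Set.mem_prod]
    exact ⟨fun h => ⟨fun j => (h j).2, fun j => (h j).1⟩, fun h j => ⟨h.2 j, h.1 j⟩⟩
  rw [← h3, Measure.map_apply measurable_rotatePair hset,
    Measure.map_apply measurable_rotatePair hset,
    Measure.prod_apply (measurable_rotatePair hset),
    Measure.prod_apply (measurable_rotatePair hset)]
  refine lintegral_mono fun u => ?_
  rw [hpre]
  exact hμ.measure_slab_blockPart_le hμ₀ hC _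

end IsCenteredGaussian

variable [DecidableEq ι] {b : ι → β} {C : Matrix ι ι ℝ}
variable {I : Type*} [Fintype I] [DecidableEq I]

/-- Covariance of `card I` block diagonal copies sharing a small common component. -/
def iterCov (b : ι → β) (C : Matrix ι ι ℝ) (I : Type*) [Fintype I] [DecidableEq I] :
    Matrix (ι × I) (ι × I) ℝ :=
  of fun p q => (if p.2 = q.2 then blockPart b C p.1 q.1 else 0) +
    (Fintype.card I : ℝ)⁻¹ * (C p.1 q.1 - blockPart b C p.1 q.1)

omit [Fintype ι] [DecidableEq ι] in
lemma iterCov_isSymm (hC : C.IsSymm) : (iterCov b C I).IsSymm := by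
  ext p q
  simp [iterCov, hC.apply q.1 p.1, (blockPart_isSymm b hC).apply q.1 p.1, eq_comm]

omit [DecidableEq ι] in
lemma sum_prod_ite_quadForm (D : Matrix ι ι ℝ) (t : ι × I → ℝ) :
    t ⬝ᵥ (of fun p q : ι × I => if p.2 = q.2 then D p.1 q.1 else 0) *ᵥ t =
      ∑ i, (fun j => t (j, i)) ⬝ᵥ D *ᵥ (fun j => t (j, i)) := by
  simp only [dotProduct, mulVec, of_apply, Fintype.sum_prod_type]
  rw [Finset.sum_comm]
  simp

omit [DecidableEq ι] [DecidableEq I] in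
lemma submatrix_fst_quadForm (D : Matrix ι ι ℝ) (t : ι × I → ℝ) :
    t ⬝ᵥ (of fun p q : ι × I => D p.1 q.1) *ᵥ t =
      (fun j => ∑ i, t (j, i)) ⬝ᵥ D *ᵥ (fun j => ∑ i, t (j, i)) := by
  simp only [dotProduct, mulVec, of_apply, Fintype.sum_prod_type, Finset.sum_mul, Finset.mul_sum]
  refine Finset.sum_congr rfl fun j _ => ?_
  rw [Finset.sum_comm]
  exact Finset.sum_congr rfl fun j' _ => Finset.sum_comm

omit [DecidableEq ι] in
lemma iterCov_quadForm (t : ι × I → ℝ) :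
    t ⬝ᵥ iterCov b C I *ᵥ t =
      ∑ i, (fun j => t (j, i)) ⬝ᵥ blockPart b C *ᵥ (fun j => t (j, i)) +
        (Fintype.card I : ℝ)⁻¹ * ((fun j => ∑ i, t (j, i)) ⬝ᵥ
          (C - blockPart b C) *ᵥ (fun j => ∑ i, t (j, i))) := by
  rw [← sum_prod_ite_quadForm, ← submatrix_fst_quadForm, ← smul_eq_mul, ← dotProduct_smul,
    ← smul_mulVec, ← dotProduct_add, ← add_mulVec]
  rfl

omit [DecidableEq ι] in
lemma blockPart_iterCov_quadForm (t : ι × I → ℝ) :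
    t ⬝ᵥ blockPart (fun p => b p.1) (iterCov b C I) *ᵥ t =
      ∑ i, (fun j => t (j, i)) ⬝ᵥ blockPart b C *ᵥ (fun j => t (j, i)) := by
  rw [← sum_prod_ite_quadForm]
  congr 2
  ext p q
  simp only [blockPart, iterCov, of_apply]
  split_ifs <;> simp

/-- The vector whose `(j, i)` coordinate is `xⱼ / √N + zⱼᵢ - N⁻¹ ∑ₖ zⱼₖ`, where `N = card I`. -/
def recenter (z : (ι → ℝ) × (ι × I → ℝ)) (p : ι × I) : ℝ :=
  (√(Fintype.card I))⁻¹ * z.1 p.1 + z.2 p - (Fintype.card I : ℝ)⁻¹ * ∑ k, z.2 (p.1, k)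

omit [Fintype ι] [DecidableEq ι] [DecidableEq I] in
lemma measurable_recenter : Measurable (recenter (ι := ι) (I := I)) := by
  unfold recenter
  fun_prop

omit [DecidableEq ι] [DecidableEq I] in
lemma dotProduct_recenter (t : ι × I → ℝ) (z : (ι → ℝ) × (ι × I → ℝ)) :
    t ⬝ᵥ recenter z = ((√(Fintype.card I))⁻¹ • fun j => ∑ i, t (j, i)) ⬝ᵥ z.1 +
      (fun p => t p - (Fintype.card I : ℝ)⁻¹ * ∑ i, t (p.1, i)) ⬝ᵥ z.2 := by
  simp only [dotProduct, recenter, Fintype.sum_prod_type, Pi.smul_apply, smul_eq_mul]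
  rw [← Finset.sum_add_distrib]
  refine Finset.sum_congr rfl fun j _ => ?_
  simp only [sub_mul, mul_sub, mul_add, Finset.sum_sub_distrib, Finset.sum_add_distrib,
    ← Finset.sum_mul, ← Finset.mul_sum]
  ring

omit [DecidableEq ι] in
lemma quadForm_recenter [Nonempty I] (hC : C.IsSymm) (t : ι × I → ℝ) :
    ((√(Fintype.card I))⁻¹ • fun j => ∑ i, t (j, i)) ⬝ᵥ
        C *ᵥ ((√(Fintype.card I))⁻¹ • fun j => ∑ i, t (j, i)) +
      ∑ i, (fun j => t (j, i) - (Fintype.card I : ℝ)⁻¹ * ∑ k, t (j, k)) ⬝ᵥ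
        blockPart b C *ᵥ (fun j => t (j, i) - (Fintype.card I : ℝ)⁻¹ * ∑ k, t (j, k)) =
      t ⬝ᵥ iterCov b C I *ᵥ t := by
  rw [iterCov_quadForm]
  set N : ℝ := (Fintype.card I : ℝ) with hN
  have hN0 : N ≠ 0 := by simp [hN]
  have hs : (√N)⁻¹ * (√N)⁻¹ = N⁻¹ := by
    rw [← mul_inv, Real.mul_self_sqrt (Nat.cast_nonneg _)]
  set m : ι → ℝ := fun j => ∑ i, t (j, i) with hm
  set T : I → ι → ℝ := fun i j => t (j, i) with hT
  set D := blockPart b C with hD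
  have hDs : D.IsSymm := blockPart_isSymm b hC
  have hsum : ∑ i, T i = m := by
    ext j
    simp [hT, hm]
  have h1 : ∀ i, (fun j => t (j, i) - N⁻¹ * ∑ k, t (j, k)) = T i - N⁻¹ • m := fun i => rfl
  have hcomm : ∀ i, m ⬝ᵥ D *ᵥ T i = T i ⬝ᵥ D *ᵥ m := fun i => by
    rw [dotProduct_mulVec, ← mulVec_transpose, hDs.eq, dotProduct_comm]
  have h2 : ∑ i, T i ⬝ᵥ D *ᵥ m = m ⬝ᵥ D *ᵥ m := by
    rw [← sum_dotProduct, hsum]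
  simp only [h1, mulVec_smul, smul_dotProduct, dotProduct_smul, smul_eq_mul,
    mulVec_sub, sub_dotProduct, dotProduct_sub, Finset.sum_sub_distrib, hcomm, ← Finset.mul_sum,
    h2, Finset.sum_const, Finset.card_univ, nsmul_eq_mul, ← hN, sub_mulVec]
  have h3 : N * (N⁻¹ * (N⁻¹ * (m ⬝ᵥ D *ᵥ m))) = N⁻¹ * (m ⬝ᵥ D *ᵥ m) := by
    field_simp
  linear_combination (m ⬝ᵥ C *ᵥ m) * hs + h3

omit [DecidableEq ι] in
lemma rotatePair_iterCov_quadForm (T : ι × I × Bool → ℝ) :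
    ((√2)⁻¹ • ((fun p : ι × I => T (p.1, p.2, true)) + fun p => T (p.1, p.2, false))) ⬝ᵥ
        iterCov b C I *ᵥ
          ((√2)⁻¹ • ((fun p : ι × I => T (p.1, p.2, true)) + fun p => T (p.1, p.2, false))) +
      ((√2)⁻¹ • ((fun p : ι × I => T (p.1, p.2, true)) - fun p => T (p.1, p.2, false))) ⬝ᵥ
        blockPart (fun p : ι × I => b p.1) (iterCov b C I) *ᵥ
          ((√2)⁻¹ • ((fun p : ι × I => T (p.1, p.2, true)) - fun p => T (p.1, p.2, false))) =
      T ⬝ᵥ iterCov b C (I × Bool) *ᵥ T := by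
  have hs : (√2)⁻¹ * (√2)⁻¹ = (1 / 2 : ℝ) := by
    rw [← mul_inv, Real.mul_self_sqrt (by norm_num)]
    norm_num
  rw [iterCov_quadForm, blockPart_iterCov_quadForm, iterCov_quadForm, add_right_comm,
    ← Finset.sum_add_distrib, Fintype.sum_prod_type]
  congr 1
  · refine Finset.sum_congr rfl fun i _ => ?_
    rw [Fintype.sum_bool]
    exact smul_add_sub_quadForm (blockPart b C) (fun j => T (j, i, true)) fun j => T (j, i, false)
  · have h : (fun j => ∑ i, ((√2)⁻¹ • ((fun p : ι × I => T (p.1, p.2, true)) +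
        fun p : ι × I => T (p.1, p.2, false))) (j, i)) = (√2)⁻¹ • fun j => ∑ i, T (j, i) := by
      ext j
      simp [Fintype.sum_prod_type, Finset.mul_sum, mul_add]
    rw [h]
    simp only [mulVec_smul, smul_dotProduct, dotProduct_smul, smul_eq_mul, Fintype.card_prod,
      Fintype.card_bool, Nat.cast_mul, Nat.cast_ofNat, mul_inv]
    set q := (fun j => ∑ i, T (j, i)) ⬝ᵥ (C - blockPart b C) *ᵥ fun j => ∑ i, T (j, i)
    linear_combination (Fintype.card I : ℝ)⁻¹ * q * hs

namespace IsCenteredGaussian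

variable {μ μ₀ : Measure (ι → ℝ)}

omit [DecidableEq ι] in
lemma map_copies (hμ₀ : IsCenteredGaussian μ₀ (blockPart b C)) :
    IsCenteredGaussian ((Measure.pi fun _ : I => μ₀).map fun z (p : ι × I) => z p.2 p.1)
      (blockPart (fun p : ι × I => b p.1) (iterCov b C I)) :=
  hμ₀.map_pi fun t => (blockPart_iterCov_quadForm t).symm

omit [DecidableEq ι] in
lemma map_recenter [Nonempty I] (hμ : IsCenteredGaussian μ C) (hC : C.IsSymm)
    {ν : Measure (ι × I → ℝ)}
    (hν : IsCenteredGaussian ν (blockPart (fun p : ι × I => b p.1) (iterCov b C I))) :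
    IsCenteredGaussian ((μ.prod ν).map recenter) (iterCov b C I) := by
  refine hμ.map_prod hν measurable_recenter _ _ dotProduct_recenter fun t => ?_
  rw [blockPart_iterCov_quadForm, quadForm_recenter hC]

/-- Iterating the doubling step. -/
lemma exists_iterCov_measure_le (hμ : IsCenteredGaussian μ C)
    (hμ₀ : IsCenteredGaussian μ₀ (blockPart b C)) (hC : C.IsSymm) (t : ι → ℝ) (k : ℕ) :
    ∃ (I : Type) (_ : Fintype I) (_ : DecidableEq I), Fintype.card I = 2 ^ k ∧
      ∀ ν : Measure (ι × I → ℝ), IsCenteredGaussian ν (iterCov b C I) →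
        ν {w | ∀ p, w p ≤ t p.1} ≤ μ {x | ∀ j, x j ≤ t j} ^ 2 ^ k := by
  induction k with
  | zero =>
    refine ⟨Unit, inferInstance, inferInstance, rfl, fun ν hν => le_of_eq ?_⟩
    have hm : Measurable fun (x : ι → ℝ) (p : ι × Unit) => x p.1 := by fun_prop
    have h1 : IsCenteredGaussian (μ.map fun x (p : ι × Unit) => x p.1) (iterCov b C Unit) := by
      refine hμ.map hm (fun t j => t (j, ())) (fun t x => ?_) fun t => ?_
      · simp [dotProduct, Fintype.sum_prod_type]
      · rw [iterCov_quadForm]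
        simp [sub_mulVec, dotProduct_sub]
    rw [hν.unique h1 fun _ => rfl, Measure.map_apply hm (measurableSet_forall_le _)]
    simp
  | succ k ih =>
    obtain ⟨I, _, _, hcard, hI⟩ := ih
    have : Nonempty I := by
      rw [← Fintype.card_pos_iff, hcard]
      positivity
    refine ⟨I × Bool, inferInstance, inferInstance, by simp [hcard, pow_succ], fun ν hν => ?_⟩
    have hν₀ := hμ₀.map_copies (I := I)
    set ν₀ := (Measure.pi fun _ : I => μ₀).map fun z (p : ι × I) => z p.2 p.1
    have hν' := hμ.map_recenter hC hν₀
    set ν' := (μ.prod ν₀).map recenter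
    have hdouble := hν'.measure_rotatePair_le hν₀ (iterCov_isSymm hC) fun p => t p.1
    have hm : Measurable fun z (p : ι × I × Bool) => rotatePair (κ := ι × I) z ((p.1, p.2.1), p.2.2) :=
      measurable_pi_lambda _ fun p => (measurable_pi_apply _).comp measurable_rotatePair
    have hlaw : IsCenteredGaussian ((ν'.prod ν₀).map
        fun z (p : ι × I × Bool) => rotatePair z ((p.1, p.2.1), p.2.2)) (iterCov b C (I × Bool)) := by
      set e : (ι × I × Bool → ℝ) → (ι × I) × Bool → ℝ := fun T q => T (q.1.1, q.1.2, q.2) with he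
      refine hν'.map_prod hν₀ hm _ _
        (fun T z => Eq.trans ?_ (dotProduct_rotatePair (e T) z)) fun T => ?_
      · simp only [dotProduct, he]
        exact Fintype.sum_equiv (Equiv.prodAssoc ι I Bool).symm _ _ fun p => rfl
      · exact rotatePair_iterCov_quadForm T
    rw [hν.unique hlaw fun _ => rfl, Measure.map_apply hm (measurableSet_forall_le _), pow_succ,
      pow_mul]
    refine le_trans (le_of_eq ?_) (hdouble.trans (pow_le_pow_left' (hI _ hν') 2))
    rw [Measure.map_apply measurable_rotatePair (measurableSet_forall_le _)]
    congr 1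
    ext z
    simp only [Set.mem_preimage, Set.mem_ofPred_eq]
    exact ⟨fun h p => h (p.1.1, p.1.2, p.2), fun h p => h ((p.1, p.2.1), p.2.2)⟩

end IsCenteredGaussian

end Doubling

section Endgame

open Filter Topology

variable {ι β : Type*} [Fintype ι] [DecidableEq β]

/-- A quantitative weak law of large numbers for centered vectors. -/
lemma measure_pi_le_abs_mean_le (η : Measure (ι → ℝ)) [IsProbabilityMeasure η]
    (hL : ∀ j, MemLp (fun x : ι → ℝ => x j) 2 η) (h0 : ∀ j, ∫ x, x j ∂η = 0) {δ : ℝ} (hδ : 0 < δ)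
    (I : Type*) [Fintype I] [Nonempty I] :
    (Measure.pi fun _ : I => η) {z | ∃ j, δ ≤ |(Fintype.card I : ℝ)⁻¹ * ∑ k, z k j|} ≤
      ENNReal.ofReal ((∑ j, Var[fun x : ι → ℝ => x j; η] / δ ^ 2) / Fintype.card I) := by
  set N : ℝ := (Fintype.card I : ℝ) with hN
  have hN0 : 0 < N := by simp [hN, Fintype.card_pos]
  have hev : ∀ j (k : I), MemLp (fun z : I → ι → ℝ => z k j) 2 (Measure.pi fun _ : I => η) :=
    fun j k => (hL j).comp_measurePreserving (measurePreserving_eval (fun _ : I => η) k)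
  have hj : ∀ j, (Measure.pi fun _ : I => η) {z | δ ≤ |N⁻¹ * ∑ k, z k j|} ≤
      ENNReal.ofReal (Var[fun x : ι → ℝ => x j; η] / δ ^ 2 / N) := by
    intro j
    set X : (I → ι → ℝ) → ℝ := ∑ k, fun z => z k j with hX
    have hXapp : ∀ z, X z = ∑ k, z k j := fun z => by simp [hX]
    have hXL : MemLp X 2 (Measure.pi fun _ : I => η) := memLp_finsetSum' _ fun k _ => hev j k
    have hvar : Var[X; Measure.pi fun _ : I => η] = N * Var[fun x : ι → ℝ => x j; η] := by
      rw [hX, variance_sum_pi (X := fun (_ : I) (x : ι → ℝ) => x j) fun _ => hL j]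
      simp [hN]
    have hmean : ∫ z, X z ∂(Measure.pi fun _ : I => η) = 0 := by
      simp only [hXapp]
      rw [integral_finsetSum _ fun k _ => (hev j k).integrable (by norm_num)]
      refine Finset.sum_eq_zero fun k _ => ?_
      rw [integral_comp_eval (μ := fun _ : I => η) (f := fun x : ι → ℝ => x j)
        (hL j).aestronglyMeasurable, h0]
    have h1 := meas_ge_le_variance_div_sq hXL (c := N * δ) (by positivity)
    rw [hmean, hvar] at h1
    have h2 : Var[fun x : ι → ℝ => x j; η] / δ ^ 2 / N =
        N * Var[fun x : ι → ℝ => x j; η] / (N * δ) ^ 2 := by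
      field_simp
    rw [h2]
    convert h1 using 2
    ext z
    simp only [Set.mem_ofPred_eq]
    rw [sub_zero, hXapp, abs_mul, abs_inv, abs_of_pos hN0, le_inv_mul_iff₀ hN0]
  calc _ = (Measure.pi fun _ : I => η) (⋃ j, {z | δ ≤ |N⁻¹ * ∑ k, z k j|}) := by
        congr 1
        ext z
        simp
    _ ≤ ∑ j, (Measure.pi fun _ : I => η) {z | δ ≤ |N⁻¹ * ∑ k, z k j|} :=
        measure_iUnion_fintype_le _ _
    _ ≤ ∑ j, ENNReal.ofReal (Var[fun x : ι → ℝ => x j; η] / δ ^ 2 / N) :=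
        Finset.sum_le_sum fun j _ => hj j
    _ = _ := by
        rw [Finset.sum_div, ENNReal.ofReal_sum_of_nonneg]
        exact fun j _ => div_nonneg (div_nonneg (variance_nonneg _ _) (sq_nonneg _)) hN0.le

lemma pi_restrict_eq_smul_pi_cond {X I : Type*} [MeasurableSpace X] [Fintype I] (μ : Measure X)
    [IsProbabilityMeasure μ] {A : Set X} (hA : MeasurableSet A) (hA0 : μ A ≠ 0) :
    (Measure.pi fun _ : I => μ).restrict (Set.univ.pi fun _ => A) =
      μ A ^ Fintype.card I • Measure.pi fun _ : I => μ[|A] := by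
  have := cond_isProbabilityMeasure hA0
  rw [Measure.restrict_pi_pi]
  refine Measure.pi_eq fun s hs => ?_
  rw [Measure.smul_apply, Measure.pi_pi, smul_eq_mul, ← Finset.card_univ, ← Finset.prod_const,
    ← Finset.prod_mul_distrib]
  refine Finset.prod_congr rfl fun i _ => ?_
  rw [cond_apply hA, Measure.restrict_apply (hs i), ← mul_assoc,
    ENNReal.mul_inv_cancel hA0 (measure_ne_top _ _), one_mul, Set.inter_comm]

namespace IsCenteredGaussian

variable {b : ι → β} {C : Matrix ι ι ℝ} {μ μ₀ : Measure (ι → ℝ)}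

lemma memLp_apply [DecidableEq ι] (hμ : IsCenteredGaussian μ C) (j : ι) {p : ENNReal}
    (hp : p ≠ ⊤) : MemLp (fun x : ι → ℝ => x j) p μ := by
  have := hμ.prob
  have hm : Measurable fun x : ι → ℝ => x j := measurable_pi_apply j
  have hq : ∀ t : ℝ, Pi.single j t ⬝ᵥ C *ᵥ Pi.single j t = t ^ 2 * C j j := fun t => by
    simp
    ring
  have hC0 : 0 ≤ C j j := by
    have := hμ.quadForm_nonneg (Pi.single j 1)
    rw [hq] at this
    simpa using this
  have := Measure.isProbabilityMeasure_map (μ := μ) hm.aemeasurable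
  have hlaw : μ.map (fun x => x j) = gaussianReal 0 (C j j).toNNReal := by
    refine Measure.ext_of_charFun (funext fun t => ?_)
    rw [charFun_apply_real, integral_map hm.aemeasurable
      (Measurable.aestronglyMeasurable (by fun_prop)), charFun_gaussianReal]
    have := hμ.charFun_eq (Pi.single j t)
    rw [hq] at this
    simp only [single_dotProduct] at this
    push_cast at this
    rw [this]
    congr 1
    simp [Real.coe_toNNReal _ hC0]
    ring
  exact (memLp_map_measure_iff aestronglyMeasurable_id hm.aemeasurable).1
    (hlaw ▸ memLp_id_gaussianReal' p hp)

lemma ae_dotProduct_eq_zero (hμ : IsCenteredGaussian μ C) {t : ι → ℝ}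
    (ht : t ⬝ᵥ C *ᵥ t = 0) : ∀ᵐ x ∂μ, t ⬝ᵥ x = 0 := by
  have := hμ.prob
  have hm : Measurable fun (x : ι → ℝ) (_ : Unit) => t ⬝ᵥ x := by
    unfold dotProduct
    fun_prop
  have h1 : IsCenteredGaussian (μ.map fun x (_ : Unit) => t ⬝ᵥ x) 0 := by
    refine hμ.map hm (fun s => s () • t) (fun s x => ?_) fun s => ?_
    · simp [dotProduct, Finset.mul_sum, mul_assoc]
    · simp [mulVec_smul, ht]
  have h2 : IsCenteredGaussian (μ.map fun _ (_ : Unit) => (0 : ℝ)) 0 :=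
    hμ.map measurable_const (fun _ => 0) (fun s x => by simp [dotProduct]) fun s => by simp
  have hs : MeasurableSet {y : Unit → ℝ | y () = 0} :=
    measurableSet_eq_fun (measurable_pi_apply _) measurable_const
  have h3 : ∀ᵐ y ∂(μ.map fun _ (_ : Unit) => (0 : ℝ)), y () = 0 := by
    rw [ae_map_iff measurable_const.aemeasurable hs]
    simp
  rw [← h1.unique h2 fun _ => rfl, ae_map_iff hm.aemeasurable hs] at h3
  exact h3

/-- The correlation inequality for half spaces, when the block diagonal law conditioned on the
orthant is centered. -/
lemma measure_orthant_blockPart_le [DecidableEq ι] (hμ : IsCenteredGaussian μ C)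
    (hμ₀ : IsCenteredGaussian μ₀ (blockPart b C)) (hC : C.IsSymm) {s δ : ℝ} (hδ : 0 < δ)
    (hcent : ∀ j, ∫ x in {x : ι → ℝ | ∀ j, x j ≤ s}, x j ∂μ₀ = 0) :
    μ₀ {x | ∀ j, x j ≤ s} ≤ μ {x | ∀ j, x j ≤ s + δ} := by
  have := hμ.prob
  have := hμ₀.prob
  set A : Set (ι → ℝ) := {x | ∀ j, x j ≤ s} with hA
  have hAm : MeasurableSet A := measurableSet_forall_le _
  by_cases hA0 : μ₀ A = 0
  · rw [hA0]
    exact zero_le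
  set η := μ₀[|A] with hη
  have : IsProbabilityMeasure η := cond_isProbabilityMeasure hA0
  have hηL : ∀ j, MemLp (fun x : ι → ℝ => x j) 2 η := fun j =>
    ((hμ₀.memLp_apply j (by norm_num)).restrict A).smul_measure (ENNReal.inv_ne_top.2 hA0)
  have hη0 : ∀ j, ∫ x, x j ∂η = 0 := fun j => by
    rw [hη, ProbabilityTheory.cond, integral_smul_measure, hcent, smul_zero]
  have hδ2 : 0 < δ / 2 := half_pos hδ
  set K := ∑ j, Var[fun x : ι → ℝ => x j; η] / (δ / 2) ^ 2 with hK
  have hpow : Tendsto (fun k : ℕ => (2 : ℝ) ^ k) atTop atTop :=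
    tendsto_pow_atTop_atTop_of_one_lt one_lt_two
  have htight : ∀ᶠ k : ℕ in atTop,
      ENNReal.ofReal (1 / 2) ≤ μ {x | ∀ j, |x j| ≤ √(2 ^ k) * (δ / 2)} := by
    have hmono : Monotone fun k : ℕ => {x : ι → ℝ | ∀ j, |x j| ≤ √(2 ^ k) * (δ / 2)} := by
      intro k l hkl x hx j
      refine (hx j).trans ?_
      gcongr
      exact one_le_two
    have h1 := tendsto_measure_iUnion_atTop (μ := μ) hmono
    have h2 : (⋃ k : ℕ, {x : ι → ℝ | ∀ j, |x j| ≤ √(2 ^ k) * (δ / 2)}) = Set.univ := by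
      refine Set.eq_univ_of_forall fun x => Set.mem_iUnion.2 ?_
      have h3 : Tendsto (fun k : ℕ => √((2 : ℝ) ^ k) * (δ / 2)) atTop atTop :=
        (Real.tendsto_sqrt_atTop.comp hpow).atTop_mul_const hδ2
      exact (eventually_all.2 fun j => h3.eventually_ge_atTop |x j|).exists
    rw [h2, measure_univ] at h1
    exact h1.eventually_const_le (by
      rw [← ENNReal.ofReal_one]
      exact (ENNReal.ofReal_lt_ofReal_iff one_pos).2 (by norm_num))
  have hlln : ∀ᶠ k : ℕ in atTop, K / 2 ^ k ≤ 1 / 2 :=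
    (hpow.const_div_atTop K).eventually_le_const (by norm_num)
  have hmain : ∀ᶠ k : ℕ in atTop, ENNReal.ofReal (1 / 4) * μ₀ A ^ 2 ^ k ≤
      μ {x | ∀ j, x j ≤ s + δ} ^ 2 ^ k := by
    filter_upwards [htight, hlln] with k hk1 hk2
    obtain ⟨I, _, _, hcard, hI⟩ := hμ.exists_iterCov_measure_le hμ₀ hC (fun _ => s + δ) k
    have : Nonempty I := by
      rw [← Fintype.card_pos_iff, hcard]
      positivity
    have hcardR : (Fintype.card I : ℝ) = 2 ^ k := by exact_mod_cast hcard
    have hmz : Measurable fun (z : I → ι → ℝ) (p : ι × I) => z p.2 p.1 := by fun_prop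
    have hν₀ := hμ₀.map_copies (I := I)
    set ν₀ := (Measure.pi fun _ : I => μ₀).map fun z (p : ι × I) => z p.2 p.1 with hν₀def
    have := hν₀.prob
    refine le_trans ?_ (hI _ (hμ.map_recenter hC hν₀))
    rw [Measure.map_apply measurable_recenter (measurableSet_forall_le _)]
    set E : Set (ι → ℝ) := {x | ∀ j, |x j| ≤ √(2 ^ k) * (δ / 2)} with hE
    set F : Set (ι × I → ℝ) := {y | (∀ p, y p ≤ s) ∧
      ¬ ∃ j, δ / 2 ≤ |(Fintype.card I : ℝ)⁻¹ * ∑ i, y (j, i)|} with hF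
    have hbad : MeasurableSet {z : I → ι → ℝ |
        ∃ j, δ / 2 ≤ |(Fintype.card I : ℝ)⁻¹ * ∑ i, z i j|} := by
      simp only [Set.ofPred_exists]
      exact MeasurableSet.iUnion fun j => measurableSet_le measurable_const (by fun_prop)
    have hbad' : MeasurableSet {y : ι × I → ℝ |
        ∃ j, δ / 2 ≤ |(Fintype.card I : ℝ)⁻¹ * ∑ i, y (j, i)|} := by
      simp only [Set.ofPred_exists]
      exact MeasurableSet.iUnion fun j => measurableSet_le measurable_const (by fun_prop)
    have hFm : MeasurableSet F := (measurableSet_forall_le fun _ => s).inter hbad'.compl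
    have hsub : E ×ˢ F ⊆ recenter ⁻¹' {w : ι × I → ℝ | ∀ p, w p ≤ s + δ} := by
      rintro ⟨x, y⟩ ⟨hx, hy1, hy2⟩ ⟨j, i⟩
      push Not at hy2
      have h1 : (√(2 ^ k))⁻¹ * x j ≤ δ / 2 := by
        rw [inv_mul_le_iff₀ (by positivity)]
        exact (le_abs_self _).trans (hx j)
      have h2 := (abs_lt.1 (hy2 j)).1
      have h3 := hy1 (j, i)
      simp only [recenter, hcardR] at h2 ⊢
      linarith
    refine le_trans ?_ (measure_mono hsub)
    rw [Measure.prod_prod]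
    have hF' : μ₀ A ^ Fintype.card I * ENNReal.ofReal (1 / 2) ≤ ν₀ F := by
      rw [hν₀def, Measure.map_apply hmz hFm]
      have : (fun (z : I → ι → ℝ) (p : ι × I) => z p.2 p.1) ⁻¹' F =
          {z | ∃ j, δ / 2 ≤ |(Fintype.card I : ℝ)⁻¹ * ∑ i, z i j|}ᶜ ∩ Set.univ.pi fun _ => A := by
        ext z
        simp only [hF, Set.mem_preimage, Set.mem_ofPred_eq, Set.mem_inter_iff, Set.mem_compl_iff,
          Set.mem_univ_pi, hA, Prod.forall, and_comm (a := ¬ _)]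
        exact and_congr_left fun _ => forall_comm
      rw [this, ← Measure.restrict_apply hbad.compl, pi_restrict_eq_smul_pi_cond μ₀ hAm hA0,
        Measure.smul_apply, smul_eq_mul, ← hη, prob_compl_eq_one_sub hbad]
      gcongr
      have h4 := measure_pi_le_abs_mean_le η hηL hη0 hδ2 I
      have h5 := h4.trans (ENNReal.ofReal_le_ofReal (hcardR ▸ hk2))
      calc ENNReal.ofReal (1 / 2) = 1 - ENNReal.ofReal (1 / 2) := by
            rw [← ENNReal.ofReal_one, ← ENNReal.ofReal_sub _ (by norm_num)]
            norm_num
        _ ≤ _ := tsub_le_tsub_left h5 _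
    rw [hcard] at hF'
    refine le_trans (le_of_eq ?_) (mul_le_mul' hk1 hF')
    rw [mul_comm (μ₀ A ^ 2 ^ k), ← mul_assoc, ← ENNReal.ofReal_mul (by norm_num)]
    norm_num
  set p := (μ₀ A).toReal with hp
  set q := (μ {x | ∀ j, x j ≤ s + δ}).toReal with hq
  have hp0 : 0 < p := ENNReal.toReal_pos hA0 (measure_ne_top _ _)
  have hmain' : ∀ᶠ k : ℕ in atTop, 1 / 4 * p ^ 2 ^ k ≤ q ^ 2 ^ k := by
    filter_upwards [hmain] with k hk
    have := ENNReal.toReal_mono (by finiteness) hk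
    rwa [ENNReal.toReal_mul, ENNReal.toReal_pow, ENNReal.toReal_pow,
      ENNReal.toReal_ofReal (by norm_num)] at this
  refine (ENNReal.toReal_le_toReal (measure_ne_top _ _) (measure_ne_top _ _)).1 ?_
  by_contra! hlt
  have hq0 : 0 < q := by
    obtain ⟨k, hk⟩ := hmain'.exists
    refine ENNReal.toReal_nonneg.lt_of_ne fun h => ?_
    rw [← hq] at h
    rw [← h, zero_pow (by positivity)] at hk
    exact absurd hk (not_le.2 (by positivity))
  have hr : 1 < p / q := (one_lt_div hq0).2 hlt
  have h6 : Tendsto (fun k : ℕ => (p / q) ^ 2 ^ k) atTop atTop :=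
    (tendsto_pow_atTop_atTop_of_one_lt hr).comp
      (tendsto_pow_atTop_atTop_of_one_lt one_lt_two)
  obtain ⟨k, hk1, hk2⟩ := (hmain'.and (h6.eventually_gt_atTop 4)).exists
  rw [div_pow, lt_div_iff₀ (by positivity)] at hk2
  linarith

end IsCenteredGaussian

end Endgame

section Integration

lemma integral_le_integral_of_forall_measure_ge_le {Ω : Type*} [MeasurableSpace Ω] {μ : Measure Ω}
    [IsProbabilityMeasure μ] {f g : Ω → ℝ} (hf : Measurable f) (hg : Measurable g)
    (hfi : Integrable f μ) (hgi : Integrable g μ)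
    (h : ∀ r, μ {ω | r ≤ f ω} ≤ μ {ω | r ≤ g ω}) : ∫ ω, f ω ∂μ ≤ ∫ ω, g ω ∂μ := by
  have hpos : ∀ {u : Ω → ℝ}, Measurable u → ∫⁻ ω, ENNReal.ofReal (u ω) ∂μ =
      ∫⁻ t in Set.Ioi 0, μ {ω | t ≤ u ω} := by
    intro u hu
    have h1 := lintegral_eq_lintegral_meas_le μ (f := fun ω => max (u ω) 0)
      (.of_forall fun ω => le_max_right _ _) (by fun_prop)
    simp only [ENNReal.ofReal_max, ENNReal.ofReal_zero, zero_le, sup_of_le_left] at h1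
    rw [h1]
    refine setLIntegral_congr_fun measurableSet_Ioi fun t ht => ?_
    simp [not_le.2 (Set.mem_Ioi.1 ht)]
  have hneg : ∀ {u : Ω → ℝ}, Measurable u → ∫⁻ ω, ENNReal.ofReal (-u ω) ∂μ =
      ∫⁻ t in Set.Ioi 0, (1 - μ {ω | -t ≤ u ω}) := by
    intro u hu
    have h1 := lintegral_eq_lintegral_meas_lt μ (f := fun ω => max (-u ω) 0)
      (.of_forall fun ω => le_max_right _ _) (by fun_prop)
    simp only [ENNReal.ofReal_max, ENNReal.ofReal_zero, zero_le, sup_of_le_left] at h1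
    rw [h1]
    refine setLIntegral_congr_fun measurableSet_Ioi fun t ht => ?_
    rw [← prob_compl_eq_one_sub (measurableSet_le measurable_const hu)]
    congr 1
    ext ω
    simp only [Set.mem_ofPred_eq, Set.mem_compl_iff, not_le, lt_max_iff,
      not_lt.2 (Set.mem_Ioi.1 ht).le, or_false]
    exact lt_neg
  rw [integral_eq_lintegral_pos_part_sub_lintegral_neg_part hfi,
    integral_eq_lintegral_pos_part_sub_lintegral_neg_part hgi]
  refine sub_le_sub (ENNReal.toReal_mono hgi.lintegral_lt_top.ne ?_)
    (ENNReal.toReal_mono hfi.neg.lintegral_lt_top.ne ?_)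
  · rw [hpos hf, hpos hg]
    exact lintegral_mono fun t => h t
  · rw [hneg hf, hneg hg]
    exact lintegral_mono fun t => tsub_le_tsub_left (h _) _

lemma integrable_iInf_of_finite {Ω κ : Type*} [MeasurableSpace Ω] {μ : Measure Ω} [Fintype κ]
    [Nonempty κ] {X : κ → Ω → ℝ} (hm : ∀ p, Measurable (X p)) (hi : ∀ p, Integrable (X p) μ) :
    Integrable (fun ω => ⨅ p, X p ω) μ := by
  refine (integrable_finsetSum Finset.univ fun p _ => (hi p).abs).mono'
    (Measurable.iInf hm).aestronglyMeasurable (.of_forall fun ω => ?_)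
  obtain ⟨p, hp⟩ := exists_eq_ciInf_of_finite (f := fun p => X p ω)
  rw [← hp]
  exact Finset.single_le_sum (f := fun p => |X p ω|) (fun _ _ => abs_nonneg _) (Finset.mem_univ p)

end Integration

section Simplex

variable {α γ : Type*} [Fintype α] [Fintype γ] [DecidableEq α] [DecidableEq γ]

/-- Covariance of independent blocks of regular simplex type. -/
def simplexCov (α γ : Type*) [DecidableEq α] [DecidableEq γ] [Fintype γ] :
    Matrix (α × γ) (α × γ) ℝ :=
  of fun p q => if p.1 = q.1 then (if p.2 = q.2 then 1 else 0) - 1 / (Fintype.card γ : ℝ) else 0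

namespace IsCenteredGaussian

variable {μ : Measure (α × γ → ℝ)}

lemma map_perm_simplexCov (hμ : IsCenteredGaussian μ (simplexCov α γ)) (e : Equiv.Perm γ) :
    μ.map (fun x p => x (p.1, e p.2)) = μ := by
  set σ : Equiv.Perm (α × γ) := Equiv.prodCongr (Equiv.refl α) e with hσ
  have h1 : IsCenteredGaussian (μ.map fun x p => x (p.1, e p.2)) (simplexCov α γ) := by
    refine hμ.map (by fun_prop) (fun t => t ∘ σ.symm) (fun t x => ?_) fun t => ?_
    · simp only [dotProduct]
      exact Fintype.sum_equiv σ _ _ fun ⟨a, i⟩ => by simp [hσ]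
    · simp only [dotProduct, mulVec]
      refine (Fintype.sum_equiv σ _ _ fun ⟨a, i⟩ => ?_).symm
      congr 1
      · simp
      · exact Fintype.sum_equiv σ _ _ fun ⟨b, j⟩ => by simp [hσ, simplexCov]
  exact h1.unique hμ fun _ => rfl

lemma setIntegral_orthant_simplexCov [Nonempty γ] (hμ : IsCenteredGaussian μ (simplexCov α γ))
    (s : ℝ) (p : α × γ) : ∫ x in {x : α × γ → ℝ | ∀ p, x p ≤ s}, x p ∂μ = 0 := by
  obtain ⟨a, i⟩ := p
  have := hμ.prob
  set A : Set (α × γ → ℝ) := {x | ∀ p, x p ≤ s} with hA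
  have hAm : MeasurableSet A := measurableSet_forall_le _
  have hperm : ∀ k, ∫ x in A, x (a, k) ∂μ = ∫ x in A, x (a, i) ∂μ := by
    intro k
    set e : Equiv.Perm γ := Equiv.swap i k with he
    have hm : Measurable fun (x : α × γ → ℝ) (p : α × γ) => x (p.1, e p.2) := by fun_prop
    have hpre : (fun (x : α × γ → ℝ) (p : α × γ) => x (p.1, e p.2)) ⁻¹' A = A := by
      ext x
      simp only [hA, Set.mem_preimage, Set.mem_ofPred_eq, Prod.forall]
      exact forall_congr' fun a => e.forall_congr_left.trans (by simp)
    conv_rhs => rw [← hμ.map_perm_simplexCov e]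
    rw [setIntegral_map hAm (Measurable.aestronglyMeasurable (by fun_prop)) hm.aemeasurable, hpre]
    simp [he]
  have hsum : ∀ᵐ x ∂μ, ∑ k, x (a, k) = 0 := by
    have h1 := hμ.ae_dotProduct_eq_zero (t := fun p => if p.1 = a then 1 else 0) (by
      simp [dotProduct, mulVec, simplexCov, Fintype.sum_prod_type])
    filter_upwards [h1] with x hx
    rw [dotProduct, Fintype.sum_prod_type, Finset.sum_comm] at hx
    simpa using hx
  have h2 : ∑ k, ∫ x in A, x (a, k) ∂μ = 0 := by
    rw [← integral_finsetSum _ fun k _ =>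
      ((hμ.memLp_apply (a, k) (p := 1) (by norm_num)).integrable le_rfl).integrableOn]
    exact integral_eq_zero_of_ae (ae_restrict_of_ae hsum)
  simp only [hperm, Finset.sum_const, Finset.card_univ, nsmul_eq_mul, mul_eq_zero,
    Nat.cast_eq_zero, Fintype.card_ne_zero, false_or] at h2
  exact h2

end IsCenteredGaussian

end Simplex

section Hamiltonian

variable {d : ℕ}

lemma trace_Qmat {ψ : Fin d → ℂ} (hd : d ≠ 0) (hψ : star ψ ⬝ᵥ ψ = 1) : (Qmat ψ).trace = 0 := by
  have : (d : ℂ) ≠ 0 := by exact_mod_cast hd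
  simp [Qmat, trace_vecMulVec, dotProduct_comm ψ, hψ, this]

lemma Qmat_isHermitian (ψ : Fin d → ℂ) : (Qmat ψ).IsHermitian := by
  ext i j
  by_cases h : i = j
  · simp [Qmat, vecMulVec_apply, h, mul_comm]
  · simp [Qmat, vecMulVec_apply, one_apply, h, Ne.symm h, mul_comm]

lemma trace_Qmat_mul_Qmat {ψ φ : Fin d → ℂ} (hd : d ≠ 0) (hψ : star ψ ⬝ᵥ ψ = 1)
    (hφ : star φ ⬝ᵥ φ = 1) :
    (Qmat ψ * Qmat φ).trace = (Complex.normSq (star ψ ⬝ᵥ φ) - 1 / d : ℝ) := by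
  have hd' : (d : ℂ) ≠ 0 := by exact_mod_cast hd
  have h1 : star φ ⬝ᵥ ψ = star (star ψ ⬝ᵥ φ) := by
    rw [star_dotProduct, dotProduct_comm]
  have h2 : (Qmat ψ * Qmat φ).trace = (vecMulVec ψ (star ψ) * Qmat φ).trace := by
    conv_lhs => rw [Qmat, sub_mul]
    simp [trace_Qmat hd hφ]
  rw [h2, Qmat, mul_sub, vecMulVec_mul_vecMulVec, trace_sub, trace_vecMulVec]
  simp [trace_vecMulVec, dotProduct_comm ψ, hψ, h1, Complex.normSq_eq_conj_mul_self]
  ring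

lemma Matrix.IsHermitian.im_trace_mul {A B : Matrix (Fin d) (Fin d) ℂ} (hA : A.IsHermitian)
    (hB : B.IsHermitian) : (A * B).trace.im = 0 := by
  have : star (A * B).trace = (A * B).trace := by
    rw [← trace_conjTranspose, conjTranspose_mul, hA.eq, hB.eq, trace_mul_comm]
  exact Complex.conj_eq_iff_im.1 this

/-- Parseval's identity for an orthonormal system spanning the traceless matrices. -/
lemma sum_trace_mul_trace {E : Fin (d ^ 2 - 1) → Matrix (Fin d) (Fin d) ℂ} (hd : d ≠ 0)
    (hE0 : ∀ k, (E k).trace = 0)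
    (hE : ∀ k l, (E k * E l).trace = if k = l then (1 : ℂ) else 0)
    {A : Matrix (Fin d) (Fin d) ℂ} (hA : A.trace = 0) (B : Matrix (Fin d) (Fin d) ℂ) :
    ∑ k, (E k * A).trace * (E k * B).trace = (A * B).trace := by
  set F : Option (Fin (d ^ 2 - 1)) → Matrix (Fin d) (Fin d) ℂ :=
    fun k => k.elim (((√d)⁻¹ : ℝ) • (1 : Matrix (Fin d) (Fin d) ℂ)) E with hF
  have hF1 : ∀ k l, (F k * F l).trace = if k = l then (1 : ℂ) else 0 := by
    have h1 : ((√d : ℝ) : ℂ)⁻¹ * (((√d : ℝ) : ℂ)⁻¹ * (d : ℂ)) = 1 := by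
      have : (√d)⁻¹ * ((√d)⁻¹ * (d : ℝ)) = 1 := by
        have h0 : (0 : ℝ) < √d := by positivity
        field_simp
        rw [Real.sq_sqrt (Nat.cast_nonneg _)]
      exact_mod_cast this
    rintro (_ | k) (_ | l)
    · simp [hF, h1]
    · simp [hF, hE0]
    · simp [hF, hE0]
    · simp [hF, hE]
  set W : Matrix (Option (Fin (d ^ 2 - 1))) (Fin d × Fin d) ℂ := of fun k p => F k p.1 p.2 with hW
  set M : Matrix (Option (Fin (d ^ 2 - 1))) (Fin d × Fin d) ℂ := of fun k p => F k p.2 p.1 with hM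
  have h1 : W * Mᵀ = 1 := by
    ext k l
    rw [mul_apply, one_apply, ← hF1 k l]
    simp [hW, hM, Fintype.sum_prod_type, trace, mul_apply]
  have h2 : Mᵀ * W = 1 := by
    refine (mul_eq_one_comm_of_card_eq _ _ _ ?_).1 h1
    have : 0 < d ^ 2 := by positivity
    simp only [Fintype.card_option, Fintype.card_fin, Fintype.card_prod, ← sq]
    omega
  set u : Fin d × Fin d → ℂ := fun p => A p.1 p.2 with hu
  set v : Fin d × Fin d → ℂ := fun p => B p.2 p.1 with hv
  have h3 : ∀ k, (M *ᵥ u) k = (F k * A).trace := fun k => by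
    simp only [mulVec, dotProduct, hM, hu, of_apply, Fintype.sum_prod_type, trace, mul_apply,
      diag_apply]
    exact Finset.sum_comm
  have h4 : ∀ k, (W *ᵥ v) k = (F k * B).trace := fun k => by
    simp [mulVec, dotProduct, hW, hv, Fintype.sum_prod_type, trace, mul_apply]
  have h5 : (M *ᵥ u) ⬝ᵥ (W *ᵥ v) = (A * B).trace := by
    rw [← vecMul_transpose, ← dotProduct_mulVec, mulVec_mulVec, h2, one_mulVec]
    simp [dotProduct, hu, hv, Fintype.sum_prod_type, trace, mul_apply]
  rw [← h5, dotProduct, Fintype.sum_option]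
  simp [h3, h4, hF, hA]

end Hamiltonian

section Ensemble

variable {d : ℕ} {E : Fin (d ^ 2 - 1) → Matrix (Fin d) (Fin d) ℂ}
  {T : Fin (d + 1) → Fin d → Fin d → ℂ}

/-- The coordinates of `-Q_ψ`, for `ψ` in the ensemble `T`, in the system `E`. -/
def negCoords (E : Fin (d ^ 2 - 1) → Matrix (Fin d) (Fin d) ℂ)
    (T : Fin (d + 1) → Fin d → Fin d → ℂ) :
    Matrix (Fin (d + 1) × Fin d) (Fin (d ^ 2 - 1)) ℝ :=
  of fun p k => -((E k * Qmat (T p.1 p.2)).trace).re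

/-- The covariance matrix of `(-Tr(H Q_ψ))_ψ` for `ψ` in the ensemble `T`. -/
def ensembleCov (T : Fin (d + 1) → Fin d → Fin d → ℂ) :
    Matrix (Fin (d + 1) × Fin d) (Fin (d + 1) × Fin d) ℝ :=
  of fun p q => Complex.normSq (star (T p.1 p.2) ⬝ᵥ T q.1 q.2) - 1 / d

lemma negCoords_mul_transpose (hd : d ≠ 0) (hEH : ∀ k, (E k).IsHermitian)
    (hE0 : ∀ k, (E k).trace = 0)
    (hE : ∀ k l, (E k * E l).trace = if k = l then (1 : ℂ) else 0) (hT : ∀ a, IsONB (T a)) :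
    negCoords E T * (1 : Matrix (Fin (d ^ 2 - 1)) (Fin (d ^ 2 - 1)) ℝ) * (negCoords E T)ᵀ =
      ensembleCov T := by
  have hunit : ∀ p : Fin (d + 1) × Fin d, star (T p.1 p.2) ⬝ᵥ T p.1 p.2 = 1 := fun p => by
    simpa using hT p.1 p.2 p.2
  have hre : ∀ k (p : Fin (d + 1) × Fin d),
      (((E k * Qmat (T p.1 p.2)).trace).re : ℂ) = (E k * Qmat (T p.1 p.2)).trace :=
    fun k p => Complex.ext (by simp)
      (by simpa using ((hEH k).im_trace_mul (Qmat_isHermitian (T p.1 p.2))).symm)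
  ext p q
  have h1 := sum_trace_mul_trace hd hE0 hE (trace_Qmat hd (hunit p)) (Qmat (T q.1 q.2))
  rw [trace_Qmat_mul_Qmat hd (hunit p) (hunit q)] at h1
  rw [← Finset.sum_congr rfl fun k _ => congrArg₂ (· * ·) (hre k p) (hre k q)] at h1
  rw [Matrix.mul_one, mul_apply]
  simp only [negCoords, ensembleCov, of_apply, transpose_apply, neg_mul_neg]
  exact_mod_cast h1

lemma ensembleCov_isSymm : (ensembleCov T).IsSymm := by
  ext p q
  have : star (T p.1 p.2) ⬝ᵥ T q.1 q.2 = star (star (T q.1 q.2) ⬝ᵥ T p.1 p.2) := by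
    rw [star_dotProduct, dotProduct_comm]
  simp [ensembleCov, this, Complex.normSq_conj]

lemma blockPart_ensembleCov (hT : ∀ a, IsONB (T a)) :
    blockPart Prod.fst (ensembleCov T) = simplexCov (Fin (d + 1)) (Fin d) := by
  ext ⟨a, i⟩ ⟨b, j⟩
  by_cases h : a = b
  · subst h
    have hij := hT a i j
    by_cases h' : i = j <;> simp_all [blockPart, ensembleCov, simplexCov]
  · simp [blockPart, simplexCov, h]

lemma IsCompleteMUB.ensembleCov_eq (hT : IsCompleteMUB T) :
    ensembleCov T = simplexCov (Fin (d + 1)) (Fin d) := by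
  rw [← blockPart_ensembleCov hT.1]
  ext ⟨a, i⟩ ⟨b, j⟩
  by_cases h : a = b
  · simp [blockPart, h]
  · simp [blockPart, ensembleCov, h, hT.2 a b i j h]

lemma re_trace_sum_smul_mul_Qmat (x : Fin (d ^ 2 - 1) → ℝ) (p : Fin (d + 1) × Fin d) :
    (((∑ k, (x k : ℂ) • E k) * Qmat (T p.1 p.2)).trace).re = -(negCoords E T *ᵥ x) p := by
  simp [negCoords, mulVec, dotProduct, Finset.sum_mul, trace_sum, mul_comm]

end Ensemble

/-- The complete MUB ensemble attains the smallest expected best-of-set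
random-Hamiltonian minimum among labelled unions of `d+1` orthonormal bases:
`E_H min_{ψ∈M} Tr(H Q_ψ) ≤ E_H min_{ψ∈S} Tr(H Q_ψ)`. -/
theorem mub_expected_min_optimal {d : ℕ} (hd : 2 ≤ d)
    (B : Fin (d + 1) → Fin d → Fin d → ℂ) (hB : IsCompleteMUB B)
    (S : Fin (d + 1) → Fin d → Fin d → ℂ) (hS : ∀ a, IsONB (S a))
    {Ω : Type*} [MeasurableSpace Ω] (μ : Measure Ω) [IsProbabilityMeasure μ]
    (H : Ω → Matrix (Fin d) (Fin d) ℂ) (hH : IsStdGaussianHamiltonian μ H) :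
    (∫ ω, (⨅ p : Fin (d + 1) × Fin d, ((H ω * Qmat (B p.1 p.2)).trace).re) ∂μ) ≤
      ∫ ω, (⨅ p : Fin (d + 1) × Fin d, ((H ω * Qmat (S p.1 p.2)).trace).re) ∂μ := by
  obtain ⟨E, g, hEH, hE0, hE, hgm, hglaw, hHeq⟩ := hH
  have hd0 : d ≠ 0 := by omega
  have : NeZero d := ⟨hd0⟩
  simp only [hHeq, re_trace_sum_smul_mul_Qmat]
  set X : (Fin (d + 1) → Fin d → Fin d → ℂ) → Ω → Fin (d + 1) × Fin d → ℝ :=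
    fun T ω => negCoords E T *ᵥ fun k => g k ω with hX
  have hXm : ∀ T, Measurable (X T) := fun T => by
    have : Measurable fun x : Fin (d ^ 2 - 1) → ℝ => negCoords E T *ᵥ x := by
      unfold mulVec dotProduct
      fun_prop
    exact this.comp hgm
  have hlaw : ∀ T, (∀ a, IsONB (T a)) → IsCenteredGaussian (μ.map (X T)) (ensembleCov T) := by
    intro T hT
    have h1 := (IsCenteredGaussian.std (ι := Fin (d ^ 2 - 1))).map_mulVec (negCoords E T)
    rw [negCoords_mul_transpose hd0 hEH hE0 hE hT, ← hglaw,
      Measure.map_map (by unfold mulVec dotProduct; fun_prop) hgm] at h1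
    exact h1
  have hXpm : ∀ T p, Measurable fun ω => -X T ω p := fun T p =>
    ((measurable_pi_apply p).comp (hXm T)).neg
  have hint : ∀ T, (∀ a, IsONB (T a)) → Integrable (fun ω => ⨅ p, -X T ω p) μ := fun T hT =>
    integrable_iInf_of_finite (hXpm T) fun p =>
      ((((hlaw T hT).memLp_apply p (p := 1) (by norm_num)).integrable le_rfl).comp_measurable
        (hXm T)).neg
  have hset : ∀ T r, μ {ω | r ≤ ⨅ p, -X T ω p} = μ.map (X T) {x | ∀ p, x p ≤ -r} := by
    intro T r
    rw [Measure.map_apply (hXm T) (measurableSet_forall_le _)]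
    congr 1
    ext ω
    simp only [Set.mem_ofPred_eq, Set.mem_preimage]
    rw [le_ciInf_iff (Set.finite_range _).bddBelow]
    exact forall_congr' fun p => le_neg
  refine le_of_forall_pos_le_add fun δ hδ => ?_
  have h1 := integral_le_integral_of_forall_measure_ge_le (μ := μ)
    (f := fun ω => ⨅ p, -X B ω p) (g := fun ω => (⨅ p, -X S ω p) + δ)
    (Measurable.iInf (hXpm B)) ((Measurable.iInf (hXpm S)).add_const δ)
    (hint B hB.1) ((hint S hS).add (integrable_const δ)) fun r => by
      have hBlaw := hlaw B hB.1
      rw [hB.ensembleCov_eq] at hBlaw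
      have h2 := (hlaw S hS).measure_orthant_blockPart_le (b := Prod.fst) (s := -r)
        ((blockPart_ensembleCov hS).symm ▸ hBlaw) ensembleCov_isSymm hδ
        (hBlaw.setIntegral_orthant_simplexCov _)
      rw [hset B r]
      refine h2.trans (le_of_eq ?_)
      rw [show -r + δ = -(r - δ) by ring, ← hset S]
      simp only [sub_le_iff_le_add]
  rw [integral_add (hint S hS) (integrable_const δ)] at h1
  simpa using h1
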